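/- Let (v,p) be a smooth axisymmetric solution with no swirl of the steady Navier–Stokes equations on the periodic slab domain D × S¹, satisfying the generalized Dirichlet integral condition with exponent q for some q ∈ (2,∞). Then lim_{r→∞} r^{2/q − 1/q²} sup_{z ∈ [-π,π]} |ω^θ(r,z)| = 0. -/

import Mathlib

open MeasureTheory Real Set Filter Topology

noncomputable section

/-- Three-dimensional Euclidean space. -/
abbrev E3 := EuclideanSpace ℝ (Fin 3)

/-- The distance to the `x₃`-axis, `r = √(x₁² + x₂²)`. -/
def rr (x : E3) : ℝ := Real.sqrt ((x 0) ^ 2 + (x 1) ^ 2)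

/-- Partial derivative of `g : ℝ³ → ℝ` in the `i`-th coordinate direction. -/
def pd (i : Fin 3) (g : E3 → ℝ) (x : E3) : ℝ := fderiv ℝ g x (EuclideanSpace.single i 1)

/-- Partial derivative in the first (radial) variable of a function of `(r,z)`. -/
def dr (f : ℝ → ℝ → ℝ) (r z : ℝ) : ℝ := deriv (fun s => f s z) r

/-- Partial derivative in the second (vertical) variable of a function of `(r,z)`. -/
def dzz (f : ℝ → ℝ → ℝ) (r z : ℝ) : ℝ := deriv (fun t => f r t) z

/-- The azimuthal vorticity `ω^θ = ∂_z v^r − ∂_r v^z` of an axisymmetric vector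
field without swirl, as a function of `(r,z)`. -/
def omTheta (vr vz : ℝ → ℝ → ℝ) (r z : ℝ) : ℝ := dzz vr r z - dr vz r z

/-- The rescaled azimuthal vorticity `Ω = ω^θ / r`. -/
def Om (vr vz : ℝ → ℝ → ℝ) (r z : ℝ) : ℝ := omTheta vr vz r z / r

/-- The squared Frobenius norm `|∇v|² = ∑ᵢⱼ (∂ᵢ vⱼ)²` of the gradient of a
vector field `v : ℝ³ → ℝ³`. -/
def gradSq3 (v : E3 → E3) (x : E3) : ℝ := ∑ i, ∑ j, (pd i (fun y => v y j) x) ^ 2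

/-- `v, p, vr, vz` constitute a smooth axisymmetric solution, without swirl, of the
steady Navier–Stokes equations in the periodic (in `x₃`, with period `2π`) slab
domain `D × S¹`, where `D = {(x₁,x₂) : √(x₁²+x₂²) > r₀}`; the functions `vr, vz`
of `(r,z)` are the cylindrical components of `v`. -/
structure AxisymNoSwirlNSSlab (r₀ : ℝ) (v : E3 → E3) (p : E3 → ℝ)
    (vr vz : ℝ → ℝ → ℝ) : Prop where
  smooth_v : ContDiffOn ℝ (⊤ : ℕ∞) v {x : E3 | r₀ < rr x}
  smooth_p : ContDiffOn ℝ (⊤ : ℕ∞) p {x : E3 | r₀ < rr x}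
  periodic : ∀ x : E3, v (x + (2 * π) • EuclideanSpace.single (2 : Fin 3) (1 : ℝ)) = v x
  axisym_no_swirl : ∀ x : E3, r₀ < rr x →
    v x 0 = vr (rr x) (x 2) * (x 0 / rr x) ∧
    v x 1 = vr (rr x) (x 2) * (x 1 / rr x) ∧
    v x 2 = vz (rr x) (x 2)
  momentum : ∀ x : E3, r₀ < rr x → ∀ j : Fin 3,
    (∑ i, v x i * pd i (fun y => v y j) x) + pd j p x
      = ∑ i, pd i (pd i (fun y => v y j)) x
  incompressible : ∀ x : E3, r₀ < rr x → (∑ i, pd i (fun y => v y i) x) = 0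

/-- The right half-plane `{(r, z) | a < r}`. -/
def halfPlane (a : ℝ) : Set (ℝ × ℝ) := {p | a < p.1}

/-- Partial derivative in the first variable. -/
def partialR (f : ℝ × ℝ → ℝ) (p : ℝ × ℝ) : ℝ := fderiv ℝ f p (1, 0)

/-- Partial derivative in the second variable. -/
def partialZ (f : ℝ × ℝ → ℝ) (p : ℝ × ℝ) : ℝ := fderiv ℝ f p (0, 1)

/-- Smoothness on the half-plane `halfPlane a`. -/
def SmoothRight (a : ℝ) (f : ℝ × ℝ → ℝ) : Prop := ContDiffOn ℝ (⊤ : ℕ∞) f (halfPlane a)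

lemma isOpen_halfPlane (a : ℝ) : IsOpen (halfPlane a) := isOpen_lt continuous_const continuous_fst

lemma halfPlane_mem_nhds {a : ℝ} {p : ℝ × ℝ} (hp : a < p.1) : halfPlane a ∈ 𝓝 p :=
  (isOpen_halfPlane a).mem_nhds hp

lemma contDiffOn_fderiv_apply {E F : Type*} [NormedAddCommGroup E] [NormedSpace ℝ E]
    [NormedAddCommGroup F] [NormedSpace ℝ F] {f : E → F} {s : Set E}
    (hf : ContDiffOn ℝ (⊤ : ℕ∞) f s) (hs : IsOpen s) (e : E) :
    ContDiffOn ℝ (⊤ : ℕ∞) (fun x => fderiv ℝ f x e) s :=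
  (hf.fderiv_of_isOpen hs (by simp)).clm_apply contDiffOn_const

namespace SmoothRight

variable {a : ℝ} {f g : ℝ × ℝ → ℝ} {p : ℝ × ℝ}

lemma partialR (hf : SmoothRight a f) : SmoothRight a (partialR f) :=
  contDiffOn_fderiv_apply hf (isOpen_halfPlane a) _

lemma partialZ (hf : SmoothRight a f) : SmoothRight a (partialZ f) :=
  contDiffOn_fderiv_apply hf (isOpen_halfPlane a) _

lemma sub (hf : SmoothRight a f) (hg : SmoothRight a g) : SmoothRight a (fun p => f p - g p) :=
  ContDiffOn.sub hf hg

lemma neg (hf : SmoothRight a f) : SmoothRight a (fun p => -f p) :=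
  ContDiffOn.neg hf

lemma div_fst (ha : 0 ≤ a) (hf : SmoothRight a f) : SmoothRight a (fun p => f p / p.1) :=
  ContDiffOn.div hf contDiffOn_fst fun _ hp => (ha.trans_lt hp).ne'

lemma differentiableAt (hf : SmoothRight a f) (hp : a < p.1) : DifferentiableAt ℝ f p :=
  (hf.contDiffAt (halfPlane_mem_nhds hp)).differentiableAt (by simp)

lemma hasFDerivAt (hf : SmoothRight a f) (hp : a < p.1) : HasFDerivAt f (fderiv ℝ f p) p :=
  (hf.differentiableAt hp).hasFDerivAt

lemma continuousOn (hf : SmoothRight a f) : ContinuousOn f (halfPlane a) :=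
  ContDiffOn.continuousOn hf

lemma congr (hf : SmoothRight a f) (h : ∀ p : ℝ × ℝ, a < p.1 → g p = f p) : SmoothRight a g :=
  ContDiffOn.congr hf h

lemma partialZ_partialR (hf : SmoothRight a f) (hp : a < p.1) :
    _root_.partialZ (_root_.partialR f) p = _root_.partialR (_root_.partialZ f) p := by
  have hd : DifferentiableAt ℝ (fderiv ℝ f) p :=
    ((hf.fderiv_of_isOpen (isOpen_halfPlane a) (m := 1) (by norm_cast)).contDiffAt
      (halfPlane_mem_nhds hp)).differentiableAt (by simp)
  have hs : IsSymmSndFDerivAt ℝ f p :=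
    (hf.contDiffAt (halfPlane_mem_nhds hp)).isSymmSndFDerivAt (by simp; norm_cast)
  have key : ∀ e e' : ℝ × ℝ,
      fderiv ℝ (fun x => fderiv ℝ f x e) p e' = fderiv ℝ (fderiv ℝ f) p e' e := by
    intro e e'
    rw [(hd.hasFDerivAt.clm_apply (hasFDerivAt_const e p)).fderiv]
    simp
  exact (key _ _).trans ((hs.eq _ _).trans (key _ _).symm)

/-- Restriction to a horizontal line. -/
lemma hasDerivAt_fst (hf : SmoothRight a f) {r z : ℝ} (hr : a < r) :
    HasDerivAt (fun s => f (s, z)) (_root_.partialR f (r, z)) r :=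
  (hf.hasFDerivAt (p := (r, z)) hr).comp_hasDerivAt r
    ((hasDerivAt_id r).prodMk (hasDerivAt_const r z))

/-- Restriction to a vertical line. -/
lemma hasDerivAt_snd (hf : SmoothRight a f) {r z : ℝ} (hr : a < r) :
    HasDerivAt (fun t => f (r, t)) (_root_.partialZ f (r, z)) z :=
  (hf.hasFDerivAt (p := (r, z)) hr).comp_hasDerivAt z
    ((hasDerivAt_const z r).prodMk (hasDerivAt_id z))

end SmoothRight

lemma hasFDerivAt_inv_fst {p : ℝ × ℝ} (hp : p.1 ≠ 0) :
    HasFDerivAt (fun p : ℝ × ℝ => p.1⁻¹)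
      (-(p.1 ^ 2)⁻¹ • ContinuousLinearMap.fst ℝ ℝ ℝ) p :=
  (hasDerivAt_inv hp).comp_hasFDerivAt p hasFDerivAt_fst

lemma fderiv_congr_of_halfPlane {a : ℝ} {f g : ℝ × ℝ → ℝ} (h : ∀ p : ℝ × ℝ, a < p.1 → f p = g p)
    {p : ℝ × ℝ} (hp : a < p.1) : f =ᶠ[𝓝 p] g := by
  filter_upwards [halfPlane_mem_nhds hp] with y hy using h y hy

/-- Taking the curl of the momentum equations in cylindrical coordinates. -/
lemma vorticity_equation {a : ℝ} (ha : 0 ≤ a) {u w P : ℝ × ℝ → ℝ}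
    (hu : SmoothRight a u) (hw : SmoothRight a w) (hP : SmoothRight a P)
    (hmr : ∀ p : ℝ × ℝ, a < p.1 → u p * partialR u p + w p * partialZ u p + partialR P p
      = partialR (partialR u) p + (partialR u p * p.1⁻¹ - u p * (p.1⁻¹ * p.1⁻¹))
        + partialZ (partialZ u) p)
    (hmz : ∀ p : ℝ × ℝ, a < p.1 → u p * partialR w p + w p * partialZ w p + partialZ P p
      = partialR (partialR w) p + partialR w p * p.1⁻¹ + partialZ (partialZ w) p)
    (hdiv : ∀ p : ℝ × ℝ, a < p.1 → partialR u p + u p * p.1⁻¹ + partialZ w p = 0)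
    {ω : ℝ × ℝ → ℝ} (hω : ∀ p : ℝ × ℝ, a < p.1 → ω p = partialZ u p - partialR w p)
    {p : ℝ × ℝ} (hp : a < p.1) :
    u p * partialR ω p + w p * partialZ ω p - u p * p.1⁻¹ * ω p
      = partialR (partialR ω) p + partialR ω p * p.1⁻¹ - ω p * (p.1⁻¹ * p.1⁻¹)
        + partialZ (partialZ ω) p := by
  have hp0 : p.1 ≠ 0 := (ha.trans_lt hp).ne'
  have hρ := hasFDerivAt_inv_fst hp0
  have dz := (((hu.hasFDerivAt hp).mul (hu.partialR.hasFDerivAt hp)).add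
    ((hw.hasFDerivAt hp).mul (hu.partialZ.hasFDerivAt hp))).add (hP.partialR.hasFDerivAt hp)
  have dz' := ((hu.partialR.partialR.hasFDerivAt hp).add
    (((hu.partialR.hasFDerivAt hp).mul hρ).sub ((hu.hasFDerivAt hp).mul (hρ.mul hρ)))).add
    (hu.partialZ.partialZ.hasFDerivAt hp)
  have er := DFunLike.congr_fun
    (dz.unique (dz'.congr_of_eventuallyEq (fderiv_congr_of_halfPlane hmr hp))) (0, 1)
  have dr := (((hu.hasFDerivAt hp).mul (hw.partialR.hasFDerivAt hp)).add
    ((hw.hasFDerivAt hp).mul (hw.partialZ.hasFDerivAt hp))).add (hP.partialZ.hasFDerivAt hp)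
  have dr' := ((hw.partialR.partialR.hasFDerivAt hp).add
    ((hw.partialR.hasFDerivAt hp).mul hρ)).add (hw.partialZ.partialZ.hasFDerivAt hp)
  have ez := DFunLike.congr_fun
    (dr.unique (dr'.congr_of_eventuallyEq (fderiv_congr_of_halfPlane hmz hp))) (1, 0)
  have d1 : ∀ q : ℝ × ℝ, a < q.1 → partialR ω q
      = partialR (partialZ u) q - partialR (partialR w) q := fun q hq => by
    have := ((hu.partialZ.hasFDerivAt hq).sub (hw.partialR.hasFDerivAt hq)).congr_of_eventuallyEq
      (fderiv_congr_of_halfPlane hω hq)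
    unfold partialR
    rw [this.fderiv]; rfl
  have d2 : ∀ q : ℝ × ℝ, a < q.1 → partialZ ω q
      = partialZ (partialZ u) q - partialZ (partialR w) q := fun q hq => by
    have := ((hu.partialZ.hasFDerivAt hq).sub (hw.partialR.hasFDerivAt hq)).congr_of_eventuallyEq
      (fderiv_congr_of_halfPlane hω hq)
    unfold partialZ
    rw [this.fderiv]; rfl
  have d11 : partialR (partialR ω) p
      = partialR (partialR (partialZ u)) p - partialR (partialR (partialR w)) p := by
    have := ((hu.partialZ.partialR.hasFDerivAt hp).sub
      (hw.partialR.partialR.hasFDerivAt hp)).congr_of_eventuallyEq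
      (fderiv_congr_of_halfPlane d1 hp)
    conv_lhs => unfold partialR
    exact congrArg (fun L : ℝ × ℝ →L[ℝ] ℝ => L (1, 0)) this.fderiv
  have d22 : partialZ (partialZ ω) p
      = partialZ (partialZ (partialZ u)) p - partialZ (partialZ (partialR w)) p := by
    have := ((hu.partialZ.partialZ.hasFDerivAt hp).sub
      (hw.partialR.partialZ.hasFDerivAt hp)).congr_of_eventuallyEq
      (fderiv_congr_of_halfPlane d2 hp)
    conv_lhs => unfold partialZ
    exact congrArg (fun L : ℝ × ℝ →L[ℝ] ℝ => L (0, 1)) this.fderiv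
  have c1 := hP.partialZ_partialR hp
  have c2 := hu.partialZ_partialR hp
  have c3 := hw.partialZ_partialR hp
  have c4 : partialZ (partialR (partialR u)) p = partialR (partialR (partialZ u)) p := by
    rw [hu.partialR.partialZ_partialR hp]
    have := fderiv_congr_of_halfPlane (fun q hq => hu.partialZ_partialR (p := q) hq) hp
    exact congrArg (fun L : ℝ × ℝ →L[ℝ] ℝ => L (1, 0)) this.fderiv_eq
  have c5 : partialR (partialZ (partialZ w)) p = partialZ (partialZ (partialR w)) p := by
    rw [← hw.partialZ.partialZ_partialR hp]
    have := fderiv_congr_of_halfPlane (fun q hq => hw.partialZ_partialR (p := q) hq) hp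
    exact (congrArg (fun L : ℝ × ℝ →L[ℝ] ℝ => L (0, 1)) this.fderiv_eq).symm
  have fz : ∀ f : ℝ × ℝ → ℝ, fderiv ℝ f p (0, 1) = partialZ f p := fun _ => rfl
  have fr : ∀ f : ℝ × ℝ → ℝ, fderiv ℝ f p (1, 0) = partialR f p := fun _ => rfl
  simp only [add_apply, sub_apply, smul_apply, Pi.mul_apply,
    ContinuousLinearMap.coe_fst', smul_eq_mul, fz, fr] at er ez
  rw [d1 p hp, d2 p hp, d11, d22, hω p hp]
  have hd := hdiv p hp
  have hi : (p.1 ^ 2)⁻¹ = p.1⁻¹ * p.1⁻¹ := by rw [sq, mul_inv]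
  rw [hi] at er ez
  rw [c1, c2, c4] at er
  rw [c5] at ez
  rw [c3]
  have hd' : (partialR u p + u p * p.1⁻¹ + partialZ w p) * (partialZ u p - partialR w p) = 0 := by
    rw [hd, zero_mul]
  linear_combination er - ez - hd'

/-- The equation for `Ω = ω / r`. -/
lemma scaled_vorticity_equation {a : ℝ} (ha : 0 ≤ a) {u w ω : ℝ × ℝ → ℝ} (hω : SmoothRight a ω)
    (h : ∀ p : ℝ × ℝ, a < p.1 → u p * partialR ω p + w p * partialZ ω p - u p * p.1⁻¹ * ω p
      = partialR (partialR ω) p + partialR ω p * p.1⁻¹ - ω p * (p.1⁻¹ * p.1⁻¹)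
        + partialZ (partialZ ω) p)
    {Ω : ℝ × ℝ → ℝ} (hΩ : ∀ p : ℝ × ℝ, a < p.1 → Ω p = ω p / p.1) {p : ℝ × ℝ} (hp : a < p.1) :
    u p * partialR Ω p + w p * partialZ Ω p
      = partialR (partialR Ω) p + 3 / p.1 * partialR Ω p + partialZ (partialZ Ω) p := by
  have hs : SmoothRight a Ω := (hω.div_fst ha).congr hΩ
  have hr : ∀ q : ℝ × ℝ, a < q.1 → ω q = q.1 * Ω q := fun q hq => by
    rw [hΩ q hq, mul_div_cancel₀ _ (ha.trans_lt hq).ne']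
  have d1 : ∀ q : ℝ × ℝ, a < q.1 → partialR ω q = q.1 * partialR Ω q + Ω q := fun q hq => by
    have := (hasFDerivAt_fst.mul (hs.hasFDerivAt hq)).congr_of_eventuallyEq
      (fderiv_congr_of_halfPlane hr hq)
    unfold partialR
    rw [this.fderiv]
    simp
  have d2 : ∀ q : ℝ × ℝ, a < q.1 → partialZ ω q = q.1 * partialZ Ω q := fun q hq => by
    have := (hasFDerivAt_fst.mul (hs.hasFDerivAt hq)).congr_of_eventuallyEq
      (fderiv_congr_of_halfPlane hr hq)
    unfold partialZ
    rw [this.fderiv]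
    simp
  have d11 : partialR (partialR ω) p = p.1 * partialR (partialR Ω) p + 2 * partialR Ω p := by
    have := ((hasFDerivAt_fst.mul (hs.partialR.hasFDerivAt hp)).add
      (hs.hasFDerivAt hp)).congr_of_eventuallyEq (fderiv_congr_of_halfPlane d1 hp)
    refine (congrArg (fun L : ℝ × ℝ →L[ℝ] ℝ => L (1, 0)) this.fderiv).trans ?_
    simp [partialR]
    ring
  have d22 : partialZ (partialZ ω) p = p.1 * partialZ (partialZ Ω) p := by
    have := (hasFDerivAt_fst.mul (hs.partialZ.hasFDerivAt hp)).congr_of_eventuallyEq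
      (fderiv_congr_of_halfPlane d2 hp)
    refine (congrArg (fun L : ℝ × ℝ →L[ℝ] ℝ => L (0, 1)) this.fderiv).trans ?_
    simp [partialZ]
  have hp0 : p.1 ≠ 0 := (ha.trans_lt hp).ne'
  have := h p hp
  rw [d1 p hp, d2 p hp, d11, d22, hr p hp] at this
  field_simp at this ⊢
  refine mul_left_cancel₀ hp0 ?_
  linear_combination this

/-- The meridian half-plane `θ = 0` inside `ℝ³`. -/
def meridian : ℝ × ℝ →L[ℝ] E3 :=
  (ContinuousLinearMap.fst ℝ ℝ ℝ).smulRight (EuclideanSpace.single (0 : Fin 3) (1 : ℝ)) +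
    (ContinuousLinearMap.snd ℝ ℝ ℝ).smulRight (EuclideanSpace.single (2 : Fin 3) (1 : ℝ))

lemma meridian_zero (p : ℝ × ℝ) : meridian p 0 = p.1 := by simp [meridian]

lemma meridian_one (p : ℝ × ℝ) : meridian p 1 = 0 := by simp [meridian]

lemma meridian_two (p : ℝ × ℝ) : meridian p 2 = p.2 := by simp [meridian]

lemma rr_meridian {p : ℝ × ℝ} (hp : 0 < p.1) : rr (meridian p) = p.1 := by
  rw [rr, meridian_zero, meridian_one]
  simp [Real.sqrt_sq hp.le]

lemma continuous_rr : Continuous rr := by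
  unfold rr
  fun_prop

lemma isOpen_lt_rr (a : ℝ) : IsOpen {x : E3 | a < rr x} := isOpen_lt continuous_const continuous_rr

lemma SmoothRight.comp_meridian {a : ℝ} (ha : 0 ≤ a) {f : E3 → ℝ}
    (hf : ContDiffOn ℝ (⊤ : ℕ∞) f {x : E3 | a < rr x}) :
    SmoothRight a (fun p => f (meridian p)) :=
  hf.comp meridian.contDiff.contDiffOn fun p hp => by
    have hp : a < p.1 := hp
    simpa [rr_meridian (ha.trans_lt hp)] using hp

section Meridian

variable {a : ℝ} {f : E3 → ℝ} {p : ℝ × ℝ}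

lemma hasFDerivAt_of_lt_rr {x : E3} (hf : ContDiffOn ℝ (⊤ : ℕ∞) f {x : E3 | a < rr x})
    (hx : a < rr x) : HasFDerivAt f (fderiv ℝ f x) x :=
  ((hf.contDiffAt ((isOpen_lt_rr a).mem_nhds hx)).differentiableAt (by simp)).hasFDerivAt

lemma contDiffOn_pd (hf : ContDiffOn ℝ (⊤ : ℕ∞) f {x : E3 | a < rr x}) (i : Fin 3) :
    ContDiffOn ℝ (⊤ : ℕ∞) (pd i f) {x : E3 | a < rr x} :=
  contDiffOn_fderiv_apply hf (isOpen_lt_rr a) _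

lemma fderiv_comp_meridian (ha : 0 ≤ a) (hf : ContDiffOn ℝ (⊤ : ℕ∞) f {x : E3 | a < rr x})
    (hp : a < p.1) :
    fderiv ℝ (fun p => f (meridian p)) p = (fderiv ℝ f (meridian p)).comp meridian :=
  ((hasFDerivAt_of_lt_rr hf (by rwa [rr_meridian (ha.trans_lt hp)])).comp p
    meridian.hasFDerivAt).fderiv

lemma partialR_comp_meridian (ha : 0 ≤ a) (hf : ContDiffOn ℝ (⊤ : ℕ∞) f {x : E3 | a < rr x})
    (hp : a < p.1) : partialR (fun p => f (meridian p)) p = pd 0 f (meridian p) := by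
  rw [partialR, fderiv_comp_meridian ha hf hp, pd]
  simp [meridian]

lemma partialZ_comp_meridian (ha : 0 ≤ a) (hf : ContDiffOn ℝ (⊤ : ℕ∞) f {x : E3 | a < rr x})
    (hp : a < p.1) : partialZ (fun p => f (meridian p)) p = pd 2 f (meridian p) := by
  rw [partialZ, fderiv_comp_meridian ha hf hp, pd]
  simp [meridian]

lemma partialR_partialR_comp_meridian (ha : 0 ≤ a)
    (hf : ContDiffOn ℝ (⊤ : ℕ∞) f {x : E3 | a < rr x}) (hp : a < p.1) :
    partialR (partialR (fun p => f (meridian p))) p = pd 0 (pd 0 f) (meridian p) := by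
  rw [← partialR_comp_meridian ha (contDiffOn_pd hf 0) hp]
  have := fderiv_congr_of_halfPlane
    (fun q (hq : a < q.1) => partialR_comp_meridian ha hf hq) hp
  exact congrArg (fun L : ℝ × ℝ →L[ℝ] ℝ => L (1, 0)) this.fderiv_eq

lemma partialZ_partialZ_comp_meridian (ha : 0 ≤ a)
    (hf : ContDiffOn ℝ (⊤ : ℕ∞) f {x : E3 | a < rr x}) (hp : a < p.1) :
    partialZ (partialZ (fun p => f (meridian p))) p = pd 2 (pd 2 f) (meridian p) := by
  rw [← partialZ_comp_meridian ha (contDiffOn_pd hf 2) hp]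
  have := fderiv_congr_of_halfPlane
    (fun q (hq : a < q.1) => partialZ_comp_meridian ha hf hq) hp
  exact congrArg (fun L : ℝ × ℝ →L[ℝ] ℝ => L (0, 1)) this.fderiv_eq

/-- The distance to the axis along the line through `meridian p` orthogonal to the meridian
half-plane. -/
lemma rr_meridian_add (p : ℝ × ℝ) (y : ℝ) :
    rr (meridian p + y • EuclideanSpace.single (1 : Fin 3) (1 : ℝ)) = √(p.1 ^ 2 + y ^ 2) := by
  simp [rr, meridian]

lemma le_sqrt_sq_add (r y : ℝ) : r ≤ √(r ^ 2 + y ^ 2) :=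
  Real.le_sqrt_of_sq_le (by nlinarith [sq_nonneg y])

lemma hasDerivAt_meridian_add (hf : ContDiffOn ℝ (⊤ : ℕ∞) f {x : E3 | a < rr x})
    (hp : a < p.1) (y : ℝ) :
    HasDerivAt (fun y : ℝ => f (meridian p + y • EuclideanSpace.single (1 : Fin 3) (1 : ℝ)))
      (pd 1 f (meridian p + y • EuclideanSpace.single (1 : Fin 3) (1 : ℝ))) y := by
  have hx : a < rr (meridian p + y • EuclideanSpace.single (1 : Fin 3) (1 : ℝ)) := by
    rw [rr_meridian_add]
    exact hp.trans_le (le_sqrt_sq_add _ _)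
  refine (hasFDerivAt_of_lt_rr hf hx).comp_hasDerivAt y ?_
  simpa using ((hasDerivAt_id y).smul_const
    (EuclideanSpace.single (1 : Fin 3) (1 : ℝ))).const_add (meridian p)

lemma pd_one_eq_deriv (hf : ContDiffOn ℝ (⊤ : ℕ∞) f {x : E3 | a < rr x}) (hp : a < p.1) :
    pd 1 f (meridian p)
      = deriv (fun y : ℝ => f (meridian p + y • EuclideanSpace.single (1 : Fin 3) (1 : ℝ))) 0 := by
  simpa using (hasDerivAt_meridian_add hf hp 0).deriv.symm

lemma pd_one_pd_one_eq_deriv (hf : ContDiffOn ℝ (⊤ : ℕ∞) f {x : E3 | a < rr x}) (hp : a < p.1) :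
    pd 1 (pd 1 f) (meridian p) = deriv (deriv
      (fun y : ℝ => f (meridian p + y • EuclideanSpace.single (1 : Fin 3) (1 : ℝ)))) 0 := by
  rw [pd_one_eq_deriv (contDiffOn_pd hf 1) hp]
  congr 1
  ext y
  exact (hasDerivAt_meridian_add hf hp y).deriv.symm

end Meridian

lemma deriv_deriv_comp_sqrt {a r : ℝ} (ha : 0 ≤ a) (hr : a < r) {g g' : ℝ → ℝ}
    (hg : ∀ s, a < s → HasDerivAt g (g' s) s) (hg' : DifferentiableAt ℝ g' r) :
    deriv (deriv (fun y : ℝ => g √(r ^ 2 + y ^ 2))) 0 = g' r / r := by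
  have hr0 : 0 < r := ha.trans_lt hr
  have hsq : ∀ y : ℝ, HasDerivAt (fun y : ℝ => √(r ^ 2 + y ^ 2)) (y / √(r ^ 2 + y ^ 2)) y := by
    intro y
    have h1 : HasDerivAt (fun y : ℝ => r ^ 2 + y ^ 2) (2 * y) y := by
      simpa using (hasDerivAt_pow 2 y).const_add (r ^ 2)
    convert h1.sqrt (by positivity) using 1
    rw [mul_div_mul_left _ _ two_ne_zero]
  have h1 : deriv (fun y : ℝ => g √(r ^ 2 + y ^ 2))
      = fun y => g' √(r ^ 2 + y ^ 2) * (y / √(r ^ 2 + y ^ 2)) := by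
    ext y
    exact ((hg _ (hr.trans_le (le_sqrt_sq_add r y))).comp y (hsq y)).deriv
  have hs0 : √(r ^ 2 + (0 : ℝ) ^ 2) = r := by simp [Real.sqrt_sq hr0.le]
  have hg'' : HasDerivAt g' (deriv g' r) √(r ^ 2 + (0 : ℝ) ^ 2) := by
    rw [hs0]; exact hg'.hasDerivAt
  have h2 := (hg''.comp (0 : ℝ) (hsq 0)).mul
    ((hasDerivAt_id (0 : ℝ)).div (hsq 0) (by rw [hs0]; exact hr0.ne'))
  rw [h1]
  refine h2.deriv.trans ?_
  simp [Real.sqrt_sq hr0.le]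
  field_simp

namespace AxisymNoSwirlNSSlab

variable {r₀ : ℝ} {v : E3 → E3} {P : E3 → ℝ} {vr vz : ℝ → ℝ → ℝ}

lemma contDiffOn_apply (h : AxisymNoSwirlNSSlab r₀ v P vr vz) (j : Fin 3) :
    ContDiffOn ℝ (⊤ : ℕ∞) (fun x => v x j) {x : E3 | r₀ < rr x} :=
  contDiffOn_euclidean.1 h.smooth_v j

lemma smoothRight (hr₀ : 0 < r₀) (h : AxisymNoSwirlNSSlab r₀ v P vr vz) (j : Fin 3) :
    SmoothRight r₀ (fun p => v (meridian p) j) :=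
  .comp_meridian hr₀.le (h.contDiffOn_apply j)

lemma apply_zero_meridian (hr₀ : 0 < r₀) (h : AxisymNoSwirlNSSlab r₀ v P vr vz) {p : ℝ × ℝ}
    (hp : r₀ < p.1) : v (meridian p) 0 = vr p.1 p.2 := by
  have hp0 := hr₀.trans hp
  have := (h.axisym_no_swirl (meridian p) (by rwa [rr_meridian hp0])).1
  rwa [rr_meridian hp0, meridian_zero, meridian_two, div_self hp0.ne', mul_one] at this

lemma apply_one_meridian (hr₀ : 0 < r₀) (h : AxisymNoSwirlNSSlab r₀ v P vr vz) {p : ℝ × ℝ}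
    (hp : r₀ < p.1) : v (meridian p) 1 = 0 := by
  have hp0 := hr₀.trans hp
  have := (h.axisym_no_swirl (meridian p) (by rwa [rr_meridian hp0])).2.1
  rwa [meridian_one, zero_div, mul_zero] at this

lemma apply_two_meridian (hr₀ : 0 < r₀) (h : AxisymNoSwirlNSSlab r₀ v P vr vz) {p : ℝ × ℝ}
    (hp : r₀ < p.1) : v (meridian p) 2 = vz p.1 p.2 := by
  have hp0 := hr₀.trans hp
  have := (h.axisym_no_swirl (meridian p) (by rwa [rr_meridian hp0])).2.2
  rwa [rr_meridian hp0, meridian_two] at this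

/-- The velocity off the meridian half-plane in terms of the velocity on it. -/
lemma apply_eq_meridian (hr₀ : 0 < r₀) (h : AxisymNoSwirlNSSlab r₀ v P vr vz) {x : E3}
    (hx : r₀ < rr x) :
    v x 0 = v (meridian (rr x, x 2)) 0 * (x 0 / rr x) ∧
    v x 1 = v (meridian (rr x, x 2)) 0 * (x 1 / rr x) ∧
    v x 2 = v (meridian (rr x, x 2)) 2 := by
  rw [h.apply_zero_meridian hr₀ (p := (rr x, x 2)) hx,
    h.apply_two_meridian hr₀ (p := (rr x, x 2)) hx]
  exact h.axisym_no_swirl x hx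

lemma periodic_meridian (h : AxisymNoSwirlNSSlab r₀ v P vr vz) (j : Fin 3) (r z : ℝ) :
    v (meridian (r, z + 2 * π)) j = v (meridian (r, z)) j := by
  have e : meridian (r, z + 2 * π)
      = meridian (r, z) + (2 * π) • EuclideanSpace.single (2 : Fin 3) (1 : ℝ) := by
    simp [meridian, add_smul, add_assoc]
  rw [e, h.periodic]

lemma apply_meridian_add (hr₀ : 0 < r₀) (h : AxisymNoSwirlNSSlab r₀ v P vr vz) {p : ℝ × ℝ}
    (hp : r₀ < p.1) (y : ℝ) :
    v (meridian p + y • EuclideanSpace.single (1 : Fin 3) (1 : ℝ)) 0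
        = v (meridian (√(p.1 ^ 2 + y ^ 2), p.2)) 0 / √(p.1 ^ 2 + y ^ 2) * p.1 ∧
    v (meridian p + y • EuclideanSpace.single (1 : Fin 3) (1 : ℝ)) 1
        = v (meridian (√(p.1 ^ 2 + y ^ 2), p.2)) 0 / √(p.1 ^ 2 + y ^ 2) * y ∧
    v (meridian p + y • EuclideanSpace.single (1 : Fin 3) (1 : ℝ)) 2
        = v (meridian (√(p.1 ^ 2 + y ^ 2), p.2)) 2 := by
  have h1 := h.apply_eq_meridian hr₀
    (x := meridian p + y • EuclideanSpace.single (1 : Fin 3) (1 : ℝ))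
    (by rw [rr_meridian_add]; exact hp.trans_le (le_sqrt_sq_add _ _))
  rw [rr_meridian_add] at h1
  have e0 : (meridian p + y • EuclideanSpace.single (1 : Fin 3) (1 : ℝ)) 0 = p.1 := by
    simp [meridian_zero]
  have e1 : (meridian p + y • EuclideanSpace.single (1 : Fin 3) (1 : ℝ)) 1 = y := by
    simp [meridian_one]
  have e2 : (meridian p + y • EuclideanSpace.single (1 : Fin 3) (1 : ℝ)) 2 = p.2 := by
    simp [meridian_two]
  rw [e0, e1, e2] at h1
  refine ⟨h1.1.trans ?_, h1.2.1.trans ?_, h1.2.2⟩ <;> ring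

lemma pd_one_apply_one (hr₀ : 0 < r₀) (h : AxisymNoSwirlNSSlab r₀ v P vr vz) {p : ℝ × ℝ}
    (hp : r₀ < p.1) : pd 1 (fun x => v x 1) (meridian p) = v (meridian p) 0 * p.1⁻¹ := by
  rw [pd_one_eq_deriv (h.contDiffOn_apply 1) hp]
  have e := funext fun y => (h.apply_meridian_add hr₀ hp y).2.1
  rw [e]
  have hp0 := hr₀.trans hp
  set g : ℝ → ℝ := fun y => v (meridian (√(p.1 ^ 2 + y ^ 2), p.2)) 0 / √(p.1 ^ 2 + y ^ 2) with hg
  have hs0 : √(p.1 ^ 2 + (0 : ℝ) ^ 2) = p.1 := by simp [Real.sqrt_sq hp0.le]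
  have hd : DifferentiableAt ℝ g 0 := by
    have hsq : DifferentiableAt ℝ (fun y : ℝ => √(p.1 ^ 2 + y ^ 2)) 0 :=
      DifferentiableAt.sqrt (by fun_prop) (by positivity)
    have h1 : DifferentiableAt ℝ (fun s => v (meridian (s, p.2)) 0) √(p.1 ^ 2 + (0 : ℝ) ^ 2) := by
      rw [hs0]
      exact ((h.smoothRight hr₀ 0).hasDerivAt_fst hp).differentiableAt
    exact (h1.comp (0 : ℝ) hsq).div hsq (by rw [hs0]; exact hp0.ne')
  have := (hd.hasDerivAt.mul (hasDerivAt_id (0 : ℝ))).deriv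
  refine this.trans ?_
  simp [hg, Real.sqrt_sq hp0.le, div_eq_mul_inv]

lemma pd_one_pd_one_apply_two (hr₀ : 0 < r₀) (h : AxisymNoSwirlNSSlab r₀ v P vr vz) {p : ℝ × ℝ}
    (hp : r₀ < p.1) : pd 1 (pd 1 (fun x => v x 2)) (meridian p)
      = partialR (fun p => v (meridian p) 2) p * p.1⁻¹ := by
  rw [pd_one_pd_one_eq_deriv (h.contDiffOn_apply 2) hp]
  have e := funext fun y => (h.apply_meridian_add hr₀ hp y).2.2
  rw [e]
  have hs := h.smoothRight hr₀ 2
  exact deriv_deriv_comp_sqrt (g := fun s => v (meridian (s, p.2)) 2) hr₀.le hp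
    (fun s hs' => hs.hasDerivAt_fst hs')
    (hs.partialR.hasDerivAt_fst (z := p.2) hp).differentiableAt

lemma pd_one_pd_one_apply_zero (hr₀ : 0 < r₀) (h : AxisymNoSwirlNSSlab r₀ v P vr vz) {p : ℝ × ℝ}
    (hp : r₀ < p.1) : pd 1 (pd 1 (fun x => v x 0)) (meridian p)
      = partialR (fun p => v (meridian p) 0) p * p.1⁻¹
        - v (meridian p) 0 * (p.1⁻¹ * p.1⁻¹) := by
  rw [pd_one_pd_one_eq_deriv (h.contDiffOn_apply 0) hp]
  have e := funext fun y => (h.apply_meridian_add hr₀ hp y).1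
  rw [e]
  have hs := (h.smoothRight hr₀ 0).div_fst hr₀.le
  have hp0 := hr₀.trans hp
  have h1 := deriv_deriv_comp_sqrt
    (g := fun s => v (meridian (s, p.2)) 0 / s * p.1) hr₀.le hp
    (fun s hs' => (hs.hasDerivAt_fst hs').mul_const p.1)
    ((hs.partialR.hasDerivAt_fst (z := p.2) hp).mul_const p.1).differentiableAt
  refine h1.trans ?_
  have h2 : HasDerivAt (fun s => v (meridian (s, p.2)) 0 / s)
    ((partialR (fun p => v (meridian p) 0) p * p.1 - v (meridian p) 0 * 1) / p.1 ^ 2) p.1 :=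
    ((h.smoothRight hr₀ 0).hasDerivAt_fst (z := p.2) hp).div (hasDerivAt_id p.1) hp0.ne'
  have h3 := (hs.hasDerivAt_fst (z := p.2) hp).unique h2
  dsimp only at h3 ⊢
  rw [h3]
  field_simp

/-- Incompressibility in cylindrical coordinates. -/
lemma incompressible_meridian (hr₀ : 0 < r₀) (h : AxisymNoSwirlNSSlab r₀ v P vr vz) {p : ℝ × ℝ}
    (hp : r₀ < p.1) : partialR (fun p => v (meridian p) 0) p + v (meridian p) 0 * p.1⁻¹
      + partialZ (fun p => v (meridian p) 2) p = 0 := by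
  have := h.incompressible (meridian p) (by rwa [rr_meridian (hr₀.trans hp)])
  rw [Fin.sum_univ_three, h.pd_one_apply_one hr₀ hp] at this
  rwa [partialR_comp_meridian hr₀.le (h.contDiffOn_apply 0) hp,
    partialZ_comp_meridian hr₀.le (h.contDiffOn_apply 2) hp]

/-- The vorticity divided by `r`, as a function on the half-plane. -/
lemma scaled_vorticity_meridian (hr₀ : 0 < r₀) (h : AxisymNoSwirlNSSlab r₀ v P vr vz)
    {Ω : ℝ × ℝ → ℝ}
    (hΩ : ∀ p : ℝ × ℝ, r₀ < p.1 → Ω p = (partialZ (fun p => v (meridian p) 0) p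
      - partialR (fun p => v (meridian p) 2) p) / p.1) {p : ℝ × ℝ} (hp : r₀ < p.1) :
    v (meridian p) 0 * partialR Ω p + v (meridian p) 2 * partialZ Ω p
      = partialR (partialR Ω) p + 3 / p.1 * partialR Ω p + partialZ (partialZ Ω) p := by
  have hu := h.smoothRight hr₀ 0
  have hw := h.smoothRight hr₀ 2
  refine scaled_vorticity_equation (u := fun p => v (meridian p) 0)
    (w := fun p => v (meridian p) 2) hr₀.le (hu.partialZ.sub hw.partialR) (fun q hq => ?_) hΩ hp
  refine vorticity_equation hr₀.le hu hw (.comp_meridian hr₀.le h.smooth_p) (fun q hq => ?_)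
    (fun q hq => ?_) (fun q hq => h.incompressible_meridian hr₀ hq) (fun _ _ => rfl) hq
  · have := h.momentum (meridian q) (by rwa [rr_meridian (hr₀.trans hq)]) 0
    rw [Fin.sum_univ_three, Fin.sum_univ_three, h.apply_one_meridian hr₀ hq,
      h.pd_one_pd_one_apply_zero hr₀ hq] at this
    rw [partialR_comp_meridian hr₀.le h.smooth_p hq,
      partialR_partialR_comp_meridian hr₀.le (h.contDiffOn_apply 0) hq,
      partialZ_partialZ_comp_meridian hr₀.le (h.contDiffOn_apply 0) hq]
    rw [partialR_comp_meridian hr₀.le (h.contDiffOn_apply 0) hq] at this ⊢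
    rw [partialZ_comp_meridian hr₀.le (h.contDiffOn_apply 0) hq]
    linear_combination this
  · have := h.momentum (meridian q) (by rwa [rr_meridian (hr₀.trans hq)]) 2
    rw [Fin.sum_univ_three, Fin.sum_univ_three, h.apply_one_meridian hr₀ hq,
      h.pd_one_pd_one_apply_two hr₀ hq] at this
    rw [partialZ_comp_meridian hr₀.le h.smooth_p hq,
      partialR_partialR_comp_meridian hr₀.le (h.contDiffOn_apply 2) hq,
      partialZ_partialZ_comp_meridian hr₀.le (h.contDiffOn_apply 2) hq]
    rw [partialR_comp_meridian hr₀.le (h.contDiffOn_apply 2) hq] at this ⊢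
    rw [partialZ_comp_meridian hr₀.le (h.contDiffOn_apply 2) hq]
    linear_combination this

end AxisymNoSwirlNSSlab

lemma second_derivative_test {φ φ' : ℝ → ℝ} {x c : ℝ} (hmax : IsLocalMax φ x)
    (h1 : ∀ᶠ s in 𝓝 x, HasDerivAt φ (φ' s) s) (h2 : HasDerivAt φ' c x) : φ' x = 0 ∧ c ≤ 0 := by
  have h0 : φ' x = 0 := hmax.hasDerivAt_eq_zero h1.self_of_nhds
  refine ⟨h0, not_lt.1 fun hc => ?_⟩
  have hd : deriv φ =ᶠ[𝓝 x] φ' := h1.mono fun s hs => hs.deriv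
  have hdd : deriv (deriv φ) x = c := by rw [hd.deriv_eq, h2.deriv]
  have hmin : IsLocalMin φ x := isLocalMin_of_deriv_deriv_pos (by rwa [hdd])
    (by rw [hd.self_of_nhds, h0]) h1.self_of_nhds.continuousAt
  have hconst : φ =ᶠ[𝓝 x] fun _ => φ x := by
    filter_upwards [hmax, hmin] with s hs hs' using le_antisymm hs hs'
  have : deriv φ =ᶠ[𝓝 x] fun _ => 0 := by
    filter_upwards [hconst.eventuallyEq_nhds] with s hs
    rw [hs.deriv_eq]; simp
  rw [this.deriv_eq] at hdd
  simp at hdd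
  exact hc.ne hdd

lemma exists_mem_Icc_neg_pi_pi {f : ℝ → ℝ} (hf : ∀ z, f (z + 2 * π) = f z) (z : ℝ) :
    ∃ y ∈ Icc (-π) π, f z = f y := by
  obtain ⟨y, hy, h⟩ := Function.Periodic.exists_mem_Ico hf two_pi_pos z (-π)
  exact ⟨y, ⟨hy.1, by linarith [hy.2]⟩, h⟩

lemma prod_Icc_subset_halfPlane {a b R c d : ℝ} (hab : a < b) :
    Icc b R ×ˢ Icc c d ⊆ halfPlane a := fun _ hp => hab.trans_le hp.1.1

/-- Weak maximum principle for the drift-diffusion operator on periodic annular regions. -/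
lemma maximum_principle {a r₁ r₂ M : ℝ} (har : a < r₁) {f u w : ℝ × ℝ → ℝ}
    (hf : SmoothRight a f) (hper : ∀ r z, f (r, z + 2 * π) = f (r, z))
    (hu : ContinuousOn u (halfPlane a)) (ha : 0 ≤ a)
    (heq : ∀ p : ℝ × ℝ, a < p.1 → u p * partialR f p + w p * partialZ f p
      = partialR (partialR f) p + 3 / p.1 * partialR f p + partialZ (partialZ f) p)
    (h₁ : ∀ z, f (r₁, z) ≤ M) (h₂ : ∀ z, f (r₂, z) ≤ M) {r : ℝ} (hr : r ∈ Icc r₁ r₂) (z : ℝ) :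
    f (r, z) ≤ M := by
  have hsub : Icc r₁ r₂ ×ˢ Icc (-π) π ⊆ halfPlane a := prod_Icc_subset_halfPlane har
  have hK : IsCompact (Icc r₁ r₂ ×ˢ Icc (-π) π) := isCompact_Icc.prod isCompact_Icc
  have hc : ContinuousOn (fun p : ℝ × ℝ => 3 / p.1 - u p) (Icc r₁ r₂ ×ˢ Icc (-π) π) :=
    (continuousOn_const.div continuousOn_fst fun p hp => (ha.trans_lt (hsub hp)).ne').sub
      (hu.mono hsub)
  obtain ⟨c, hcb⟩ := hK.exists_bound_of_continuousOn hc
  set l : ℝ := max c 0 + 1 with hl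
  have hl0 : 0 < l := by positivity
  have hlb : ∀ p ∈ Icc r₁ r₂ ×ˢ Icc (-π) π, -l < 3 / p.1 - u p := fun p hp => by
    have := neg_le_of_abs_le (hcb p hp)
    have := le_max_left c 0
    linarith
  obtain ⟨z', hz', hzz'⟩ := exists_mem_Icc_neg_pi_pi (f := fun z => f (r, z)) (hper r) z
  rw [hzz']
  refine le_of_forall_pos_le_add fun δ hδ => ?_
  set ε : ℝ := δ / exp (l * r₂) with hε
  have hε0 : 0 < ε := by positivity
  set g : ℝ × ℝ → ℝ := fun p => f p + ε * exp (l * p.1) with hg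
  have hgc : ContinuousOn g (Icc r₁ r₂ ×ˢ Icc (-π) π) :=
    (hf.continuousOn.mono hsub).add (by fun_prop)
  obtain ⟨⟨r₀, z₀⟩, hp₀, hmax⟩ := hK.exists_isMaxOn ⟨(r, z'), hr, hz'⟩ hgc
  have hglob : ∀ s ∈ Icc r₁ r₂, ∀ t, g (s, t) ≤ g (r₀, z₀) := fun s hs t => by
    obtain ⟨t', ht', htt'⟩ := exists_mem_Icc_neg_pi_pi (f := fun t => f (s, t)) (hper s) t
    have : g (s, t) = g (s, t') := by simp only [hg, htt']
    rw [this]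
    exact hmax (a := (s, t')) ⟨hs, ht'⟩
  have har₀ : a < r₀ := hsub hp₀
  have hend : f (r₀, z₀) ≤ M := by
    rcases hp₀.1.1.eq_or_lt with h | hlt₁
    · exact (congrArg (fun s => f (s, z₀)) h).symm.trans_le (h₁ z₀)
    rcases hp₀.1.2.eq_or_lt with h | hlt₂
    · exact (congrArg (fun s => f (s, z₀)) h).trans_le (h₂ z₀)
    exfalso
    dsimp only at hlt₁ hlt₂
    have hexp : ∀ s : ℝ, HasDerivAt (fun s => exp (l * s)) (exp (l * s) * l) s := fun s => by
      simpa using ((hasDerivAt_id s).const_mul l).exp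
    have hR := second_derivative_test (φ := fun s => g (s, z₀))
      (φ' := fun s => partialR f (s, z₀) + ε * (exp (l * s) * l))
      (c := partialR (partialR f) (r₀, z₀) + ε * (exp (l * r₀) * l * l))
      (by filter_upwards [Icc_mem_nhds hlt₁ hlt₂] with s hs using hglob s hs z₀)
      (by
        filter_upwards [lt_mem_nhds har₀] with s hs
        exact (hf.hasDerivAt_fst hs).add ((hexp s).const_mul ε))
      ((hf.partialR.hasDerivAt_fst har₀).add (((hexp r₀).mul_const l).const_mul ε))
    have hZ := second_derivative_test (φ := fun t => f (r₀, t))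
      (φ' := fun t => partialZ f (r₀, t)) (c := partialZ (partialZ f) (r₀, z₀)) (x := z₀)
      (.of_forall fun t => by
        have := hglob r₀ hp₀.1 t
        simp only [hg] at this
        linarith)
      (.of_forall fun t => hf.hasDerivAt_snd har₀) (hf.partialZ.hasDerivAt_snd har₀)
    have he := heq (r₀, z₀) har₀
    rw [hZ.1, eq_neg_of_add_eq_zero_left hR.1] at he
    dsimp only at he
    have h3 := hlb _ hp₀
    have hpos : 0 < ε * (exp (l * r₀) * l) := by positivity
    have := mul_lt_mul_of_pos_left h3 hpos
    dsimp only at this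
    nlinarith [hR.2, hZ.2]
  have h1 : g (r, z') ≤ g (r₀, z₀) := hglob r hr z'
  have h2 : ε * exp (l * r₀) ≤ δ := by
    rw [hε, div_mul_eq_mul_div, div_le_iff₀ (exp_pos _)]
    exact mul_le_mul_of_nonneg_left
      (exp_le_exp.2 (mul_le_mul_of_nonneg_left hp₀.1.2 hl0.le)) hδ.le
  have h3 : 0 ≤ ε * exp (l * r) := by positivity
  simp only [hg] at h1
  linarith

lemma continuous_clamp {a b : ℝ} (hab : a < b) {f : ℝ × ℝ → ℝ}
    (hf : ContinuousOn f (halfPlane a)) : Continuous fun p : ℝ × ℝ => f (max p.1 b, p.2) :=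
  hf.comp_continuous (by fun_prop) fun p => hab.trans_le (le_max_right p.1 b)

lemma continuousOn_integral_snd {a b : ℝ} (hab : a < b) {f : ℝ × ℝ → ℝ}
    (hf : ContinuousOn f (halfPlane a)) :
    ContinuousOn (fun r => ∫ z in -π..π, f (r, z)) (Ici b) := by
  have := intervalIntegral.continuous_parametric_intervalIntegral_of_continuous' (μ := volume)
    (f := fun r z => f (max r b, z)) (continuous_clamp hab hf) (-π) π
  refine this.continuousOn.congr fun r hr => ?_
  simp only [max_eq_left (mem_Ici.1 hr)]

lemma intervalIntegrable_of_continuousOn_Ici {b c d : ℝ} {F : ℝ → ℝ}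
    (hF : ContinuousOn F (Ici b)) (hc : b ≤ c) (hd : b ≤ d) :
    IntervalIntegrable F volume c d :=
  (hF.mono fun _ hx => (le_min hc hd).trans hx.1).intervalIntegrable

lemma continuous_slice {a r : ℝ} (har : a < r) {f : ℝ × ℝ → ℝ}
    (hf : ContinuousOn f (halfPlane a)) : Continuous fun z => f (r, z) :=
  hf.comp_continuous (by fun_prop) fun _ => har

lemma integral_integral_swap_of_continuousOn {a b R c d : ℝ} (hab : a < b) (hbR : b ≤ R)
    {f : ℝ × ℝ → ℝ} (hf : ContinuousOn f (halfPlane a)) :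
    ∫ r in b..R, ∫ z in c..d, f (r, z) = ∫ z in c..d, ∫ r in b..R, f (r, z) := by
  have hg := continuous_clamp hab hf
  have hL : ∀ z, ∫ r in b..R, f (r, z) = ∫ r in b..R, f (max r b, z) := fun z => by
    refine intervalIntegral.integral_congr fun r hr => ?_
    rw [uIcc_of_le hbR] at hr
    simp only [max_eq_left hr.1]
  have hR : ∫ r in b..R, ∫ z in c..d, f (r, z) = ∫ r in b..R, ∫ z in c..d, f (max r b, z) := by
    refine intervalIntegral.integral_congr fun r hr => ?_
    rw [uIcc_of_le hbR] at hr
    simp only [max_eq_left hr.1]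
  simp only [hL, hR]
  refine intervalIntegral_intervalIntegral_swap ?_
  exact (hg.continuousOn.integrableOn_compact
    (isCompact_uIcc.prod isCompact_uIcc)).mono_set (prod_mono uIoc_subset_uIcc uIoc_subset_uIcc)

/-- The radial velocity grows at most linearly in `L¹` of a period. -/
lemma exists_integral_abs_le {a b q M : ℝ} (ha : 0 ≤ a) (hab : a < b) (hq : 1 ≤ q)
    {u : ℝ × ℝ → ℝ} (hu : SmoothRight a u)
    (hM : ∀ R, b ≤ R → ∫ r in b..R, ∫ z in -π..π, r * |partialR u (r, z)| ^ q ≤ M) :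
    ∃ C, 0 ≤ C ∧ ∀ r, b ≤ r → ∫ z in -π..π, |u (r, z)| ≤ C * r := by
  have hb : 0 < b := ha.trans_lt hab
  have hπ : -π ≤ π := by linarith [pi_pos]
  have hM0 : 0 ≤ M := by simpa using hM b le_rfl
  set A : ℝ := ∫ z in -π..π, |u (b, z)| with hA
  have hA0 : 0 ≤ A := intervalIntegral.integral_nonneg hπ fun _ _ => abs_nonneg _
  refine ⟨A / b + 2 * π + M / b / b, by positivity, fun r hr => ?_⟩
  have hcR : ContinuousOn (fun p : ℝ × ℝ => |partialR u p| ^ q) (halfPlane a) :=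
    hu.partialR.continuousOn.abs.rpow_const fun _ _ => Or.inr (by linarith)
  have hc : ContinuousOn (fun p : ℝ × ℝ => p.1 * |partialR u p| ^ q) (halfPlane a) :=
    continuousOn_fst.mul hcR
  have hc' : ContinuousOn (fun p : ℝ × ℝ => 1 + b⁻¹ * (p.1 * |partialR u p| ^ q))
      (halfPlane a) := continuousOn_const.add (continuousOn_const.mul hc)
  have hline : ∀ z, ∀ f : ℝ × ℝ → ℝ, ContinuousOn f (halfPlane a) →
      IntervalIntegrable (fun s => f (s, z)) volume b r := fun z f hf =>
    intervalIntegrable_of_continuousOn_Ici (b := b)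
      (hf.comp (by fun_prop) fun s hs => hab.trans_le hs) le_rfl hr
  have hpt : ∀ z, |u (r, z)| ≤ |u (b, z)|
      + ∫ s in b..r, (1 + b⁻¹ * (s * |partialR u (s, z)| ^ q)) := fun z => by
    have h1 : ∫ s in b..r, partialR u (s, z) = u (r, z) - u (b, z) :=
      intervalIntegral.integral_eq_sub_of_hasDerivAt (fun s hs => by
        rw [uIcc_of_le hr] at hs
        exact hu.hasDerivAt_fst (hab.trans_le hs.1)) (hline z _ hu.partialR.continuousOn)
    have h2 : |∫ s in b..r, partialR u (s, z)|
        ≤ ∫ s in b..r, (1 + b⁻¹ * (s * |partialR u (s, z)| ^ q)) := by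
      refine (intervalIntegral.abs_integral_le_integral_abs hr).trans ?_
      refine intervalIntegral.integral_mono_on hr (hline z _ hu.partialR.continuousOn.abs)
        (hline z _ hc') fun s hs => ?_
      have hbs : 1 ≤ b⁻¹ * s := by
        rw [inv_mul_eq_div, one_le_div hb]; exact hs.1
      have hx : |partialR u (s, z)| ≤ 1 + |partialR u (s, z)| ^ q := by
        rcases le_total |partialR u (s, z)| 1 with h | h
        · exact h.trans (by linarith [rpow_nonneg (abs_nonneg (partialR u (s, z))) q])
        · linarith [self_le_rpow_of_one_le h hq]
      have := mul_le_mul_of_nonneg_right hbs (rpow_nonneg (abs_nonneg (partialR u (s, z))) q)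
      linarith
    have h3 : u (r, z) = u (b, z) + ∫ s in b..r, partialR u (s, z) := by rw [h1]; ring
    calc |u (r, z)| ≤ |u (b, z)| + |∫ s in b..r, partialR u (s, z)| := by
          conv_lhs => rw [h3]
          exact abs_add_le _ _
      _ ≤ _ := by linarith
  have hcz : Continuous fun z => ∫ s in b..r, (1 + b⁻¹ * (s * |partialR u (s, z)| ^ q)) := by
    have h := intervalIntegral.continuous_parametric_intervalIntegral_of_continuous' (μ := volume)
      (f := fun z s => (1 + b⁻¹ * (max s b * |partialR u (max s b, z)| ^ q)))
      ((continuous_clamp hab hc').comp continuous_swap) b r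
    refine h.congr fun z => intervalIntegral.integral_congr fun s hs => ?_
    rw [uIcc_of_le hr] at hs
    simp only [max_eq_left hs.1]
  have hub := (continuous_slice hab hu.continuousOn).abs
  calc ∫ z in -π..π, |u (r, z)|
      ≤ ∫ z in -π..π, (|u (b, z)| + ∫ s in b..r, (1 + b⁻¹ * (s * |partialR u (s, z)| ^ q))) :=
        intervalIntegral.integral_mono_on hπ
          ((continuous_slice (hab.trans_le hr) hu.continuousOn).abs.intervalIntegrable _ _)
          ((hub.add hcz).intervalIntegrable _ _) fun z _ => hpt z
    _ = A + ∫ s in b..r, ∫ z in -π..π, (1 + b⁻¹ * (s * |partialR u (s, z)| ^ q)) := by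
        rw [intervalIntegral.integral_add (hub.intervalIntegrable _ _)
          (hcz.intervalIntegrable _ _), integral_integral_swap_of_continuousOn hab hr hc']
    _ = A + ∫ s in b..r, (2 * π + b⁻¹ * ∫ z in -π..π, s * |partialR u (s, z)| ^ q) := by
        congr 1
        refine intervalIntegral.integral_congr fun s hs => ?_
        rw [uIcc_of_le hr] at hs
        have has : a < s := hab.trans_le hs.1
        rw [intervalIntegral.integral_add (by simp)
          (((continuous_slice has hc).const_mul _).intervalIntegrable _ _),
          intervalIntegral.integral_const_mul]
        simp
        ring
    _ = A + (2 * π * (r - b) + b⁻¹ * ∫ s in b..r, ∫ z in -π..π, s * |partialR u (s, z)| ^ q) := by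
        have := intervalIntegrable_of_continuousOn_Ici (continuousOn_integral_snd hab hc) le_rfl hr
        rw [intervalIntegral.integral_add (by simp) (this.const_mul _),
          intervalIntegral.integral_const_mul]
        simp
        ring
    _ ≤ A + (2 * π * (r - b) + b⁻¹ * M) := by
        have := hM r hr
        gcongr
    _ ≤ (A / b + 2 * π + M / b / b) * r := by
        have h1 : A ≤ A / b * r := by
          rw [div_mul_eq_mul_div, le_div_iff₀ hb]; gcongr
        have h2 : b⁻¹ * M ≤ M / b / b * r := by
          rw [inv_mul_eq_div, div_mul_eq_mul_div, le_div_iff₀ hb]; gcongr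
        nlinarith [pi_pos]

lemma fderiv_periodic {f : ℝ × ℝ → ℝ} (hf : ∀ r z, f (r, z + 2 * π) = f (r, z)) (r z : ℝ) :
    fderiv ℝ f (r, z + 2 * π) = fderiv ℝ f (r, z) := by
  have hs : (fun p : ℝ × ℝ => f (p + (0, 2 * π))) = f := by
    ext ⟨s, t⟩
    simpa using hf s t
  have := fderiv_comp_add_right (𝕜 := ℝ) (f := f) (x := ((r, z) : ℝ × ℝ)) (0, 2 * π)
  rw [hs] at this
  rw [this]
  simp

lemma partialR_periodic {f : ℝ × ℝ → ℝ} (hf : ∀ r z, f (r, z + 2 * π) = f (r, z)) (r z : ℝ) :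
    partialR f (r, z + 2 * π) = partialR f (r, z) := by
  rw [partialR, fderiv_periodic hf, partialR]

lemma partialZ_periodic {f : ℝ × ℝ → ℝ} (hf : ∀ r z, f (r, z + 2 * π) = f (r, z)) (r z : ℝ) :
    partialZ f (r, z + 2 * π) = partialZ f (r, z) := by
  rw [partialZ, fderiv_periodic hf, partialZ]

lemma hasDerivAt_abs_rpow_mul_self {q : ℝ} (hq : 2 < q) (x : ℝ) :
    HasDerivAt (fun x : ℝ => |x| ^ (q - 2) * x) ((q - 1) * |x| ^ (q - 2)) x := by
  rcases eq_or_ne x 0 with rfl | hx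
  · rw [hasDerivAt_iff_tendsto_slope_zero, abs_zero,
      zero_rpow (by linarith : q - 2 ≠ 0), mul_zero, mul_zero]
    have hc : Tendsto (fun t : ℝ => |t| ^ (q - 2)) (𝓝[≠] 0) (𝓝 0) := by
      have : Continuous fun t : ℝ => |t| ^ (q - 2) :=
        continuous_abs.rpow_const fun _ => Or.inr (by linarith)
      have h0 := this.tendsto 0
      rw [abs_zero, zero_rpow (by linarith)] at h0
      exact h0.mono_left nhdsWithin_le_nhds
    refine hc.congr' ?_
    filter_upwards [self_mem_nhdsWithin] with t ht
    have ht : t ≠ 0 := ht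
    simp
    field_simp
  · have h1 := ((hasDerivAt_abs hx).rpow_const (p := q - 2) (Or.inl (abs_ne_zero.2 hx))).mul
      (hasDerivAt_id x)
    refine h1.congr_deriv ?_
    have h2 : |x| ^ (q - 2 - 1) * |x| = |x| ^ (q - 2) := by
      rw [← rpow_add_one (abs_ne_zero.2 hx)]; congr 1; ring
    have h3 : (SignType.sign x : ℝ) * x = |x| := by simp
    simp only [id]
    linear_combination (q - 2) * |x| ^ (q - 2 - 1) * h3 + (q - 2) * h2

/-- Testing the equation for `Ω` with `φ(r) |Ω|^{q-2} Ω`. -/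
lemma energy_identity {a b R q : ℝ} (ha : 0 ≤ a) (hab : a < b) (hbR : b ≤ R) (hq : 2 < q)
    {u w Ω : ℝ × ℝ → ℝ} (hu : SmoothRight a u) (hw : SmoothRight a w) (hΩ : SmoothRight a Ω)
    (hwper : ∀ r z, w (r, z + 2 * π) = w (r, z)) (hΩper : ∀ r z, Ω (r, z + 2 * π) = Ω (r, z))
    (hdiv : ∀ p : ℝ × ℝ, a < p.1 → partialR u p + u p * p.1⁻¹ + partialZ w p = 0)
    (heq : ∀ p : ℝ × ℝ, a < p.1 → u p * partialR Ω p + w p * partialZ Ω p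
      = partialR (partialR Ω) p + 3 / p.1 * partialR Ω p + partialZ (partialZ Ω) p)
    {φ φ' φ'' : ℝ → ℝ} (hφ : ∀ r, a < r → HasDerivAt φ (φ' r) r)
    (hφ' : ∀ r, a < r → HasDerivAt φ' (φ'' r) r) (hφ'' : ContinuousOn φ'' (Ioi a)) :
    let F : ℝ × ℝ → ℝ := fun p => φ p.1 * (p.1 * (q * (|Ω p| ^ (q - 2) * Ω p) * partialR Ω p)
      + (2 - p.1 * u p) * |Ω p| ^ q) - p.1 * φ' p.1 * |Ω p| ^ q
    ∫ r in b..R, ∫ z in -π..π,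
      (φ r * r * (q * (q - 1) * |Ω (r, z)| ^ (q - 2)
          * (partialR Ω (r, z) ^ 2 + partialZ Ω (r, z) ^ 2))
        + (φ' r - r * φ'' r - φ' r * r * u (r, z)) * |Ω (r, z)| ^ q)
      = (∫ z in -π..π, F (R, z)) - ∫ z in -π..π, F (b, z) := by
  intro F
  let G : ℝ × ℝ → ℝ := fun p => φ p.1 * (p.1 * (q * (|Ω p| ^ (q - 2) * Ω p) * partialZ Ω p)
      - p.1 * w p * |Ω p| ^ q)
  let E : ℝ × ℝ → ℝ := fun p => φ p.1 * p.1 * (q * (q - 1) * |Ω p| ^ (q - 2)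
          * (partialR Ω p ^ 2 + partialZ Ω p ^ 2))
        + (φ' p.1 - p.1 * φ'' p.1 - φ' p.1 * p.1 * u p) * |Ω p| ^ q
  have key : ∀ p : ℝ × ℝ, a < p.1 → DifferentiableAt ℝ F p ∧ DifferentiableAt ℝ G p ∧
      fderiv ℝ F p (1, 0) + fderiv ℝ G p (0, 1) = E p := fun p hp => by
    have hp0 : p.1 ≠ 0 := (ha.trans_lt hp).ne'
    have h1 : HasFDerivAt (fun p : ℝ × ℝ => p.1) (ContinuousLinearMap.fst ℝ ℝ ℝ) p :=
      hasFDerivAt_fst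
    have dφ := (hφ p.1 hp).comp_hasFDerivAt p h1
    have dφ' := (hφ' p.1 hp).comp_hasFDerivAt p h1
    have dh := (hasDerivAt_abs_rpow (Ω p) (p := q) (by linarith)).comp_hasFDerivAt p
      (hΩ.hasFDerivAt hp)
    have dn := (hasDerivAt_abs_rpow_mul_self hq (Ω p)).comp_hasFDerivAt p (hΩ.hasFDerivAt hp)
    have du := hu.hasFDerivAt hp
    have dw := hw.hasFDerivAt hp
    have dF : HasFDerivAt F _ p := (dφ.mul ((h1.mul ((dn.const_mul q).mul
      (hΩ.partialR.hasFDerivAt hp))).add (((h1.mul du).const_sub 2).mul dh))).sub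
      ((h1.mul dφ').mul dh)
    have dG : HasFDerivAt G _ p := dφ.mul ((h1.mul ((dn.const_mul q).mul
      (hΩ.partialZ.hasFDerivAt hp))).sub ((h1.mul dw).mul dh))
    refine ⟨dF.differentiableAt, dG.differentiableAt, ?_⟩
    have fz : ∀ f : ℝ × ℝ → ℝ, fderiv ℝ f p (0, 1) = partialZ f p := fun _ => rfl
    have fr : ∀ f : ℝ × ℝ → ℝ, fderiv ℝ f p (1, 0) = partialR f p := fun _ => rfl
    rw [dF.fderiv, dG.fderiv]
    simp only [add_apply, sub_apply, smul_apply, neg_apply, Pi.mul_apply, Pi.add_apply,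
      Function.comp_apply,
      ContinuousLinearMap.coe_fst', smul_eq_mul, fz, fr, E]
    have e1 := heq p hp
    have e2 : p.1 * partialR u p + u p + p.1 * partialZ w p = 0 := by
      have := hdiv p hp
      field_simp at this
      linear_combination this
    have e3 : p.1 * (u p * partialR Ω p + w p * partialZ Ω p)
      = p.1 * partialR (partialR Ω) p + 3 * partialR Ω p + p.1 * partialZ (partialZ Ω) p := by
      rw [e1]; field_simp
    linear_combination (-q * (|Ω p| ^ (q - 2) * Ω p) * φ p.1) * e3 - φ p.1 * |Ω p| ^ q * e2
  have hsub : Icc b R ×ˢ Icc (-π) π ⊆ halfPlane a := prod_Icc_subset_halfPlane hab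
  have hu1 : uIcc b R = Icc b R := uIcc_of_le hbR
  have hu2 : uIcc (-π) π = Icc (-π) π := uIcc_of_le (by linarith [pi_pos])
  have hfst : MapsTo Prod.fst (halfPlane a) (Ioi a) := fun p hp => hp
  have cφ : ContinuousOn (fun p : ℝ × ℝ => φ p.1) (halfPlane a) :=
    ContinuousOn.comp (fun r hr => (hφ r hr).continuousAt.continuousWithinAt) continuousOn_fst hfst
  have cφ' : ContinuousOn (fun p : ℝ × ℝ => φ' p.1) (halfPlane a) :=
    ContinuousOn.comp (fun r hr => (hφ' r hr).continuousAt.continuousWithinAt) continuousOn_fst hfst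
  have cφ'' : ContinuousOn (fun p : ℝ × ℝ => φ'' p.1) (halfPlane a) :=
    hφ''.comp continuousOn_fst hfst
  have cn : ContinuousOn (fun p => |Ω p| ^ (q - 2)) (halfPlane a) :=
    hΩ.continuousOn.abs.rpow_const fun _ _ => Or.inr (by linarith)
  have ch : ContinuousOn (fun p => |Ω p| ^ q) (halfPlane a) :=
    hΩ.continuousOn.abs.rpow_const fun _ _ => Or.inr (by linarith)
  have cE : ContinuousOn E (halfPlane a) :=
    ((cφ.mul continuousOn_fst).mul ((continuousOn_const.mul cn).mul
      ((hΩ.partialR.continuousOn.pow 2).add (hΩ.partialZ.continuousOn.pow 2)))).add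
      (((cφ'.sub (continuousOn_fst.mul cφ'')).sub
        ((cφ'.mul continuousOn_fst).mul hu.continuousOn)).mul ch)
  have hdvg := integral2_divergence_prod_of_hasFDerivAt_off_countable F G (fderiv ℝ F)
    (fderiv ℝ G) b (-π) R π ∅ countable_empty
    (fun p hp => by
      rw [hu1, hu2] at hp
      exact (key p (hsub hp)).1.continuousAt.continuousWithinAt)
    (fun p hp => by
      rw [hu1, hu2] at hp
      exact (key p (hsub hp)).2.1.continuousAt.continuousWithinAt)
    (fun p hp => by
      rw [min_eq_left hbR] at hp
      exact (key p (hab.trans hp.1.1.1)).1.hasFDerivAt)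
    (fun p hp => by
      rw [min_eq_left hbR] at hp
      exact (key p (hab.trans hp.1.1.1)).2.1.hasFDerivAt)
    (by
      rw [hu1, hu2]
      refine ((cE.mono hsub).integrableOn_compact (isCompact_Icc.prod isCompact_Icc)).congr_fun
        (fun p hp => ((key p (hsub hp)).2.2).symm) (measurableSet_Icc.prod measurableSet_Icc))
  have hG : ∀ r, G (r, π) = G (r, -π) := fun r => by
    have e : (π : ℝ) = -π + 2 * π := by ring
    have h1 : Ω (r, π) = Ω (r, -π) := by conv_lhs => rw [e, hΩper]
    have h2 : w (r, π) = w (r, -π) := by conv_lhs => rw [e, hwper]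
    have h3 : partialZ Ω (r, π) = partialZ Ω (r, -π) := by
      conv_lhs => rw [e, partialZ_periodic hΩper]
    simp only [G, h1, h2, h3]
  simp only [hG, sub_self, zero_add] at hdvg
  rw [← hdvg]
  refine intervalIntegral.integral_congr fun r hr => intervalIntegral.integral_congr fun z _ => ?_
  rw [hu1] at hr
  exact (key (r, z) (hab.trans_le hr.1)).2.2.symm

lemma le_integral_add_integral_abs_deriv {h h' : ℝ → ℝ} (hd : ∀ z, HasDerivAt h (h' z) z)
    (hc : Continuous h') (h0 : ∀ z, 0 ≤ h z) {z : ℝ} (hz : z ∈ Icc (-π) π) :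
    h z ≤ (∫ t in -π..π, h t) + ∫ t in -π..π, |h' t| := by
  have hπ : -π ≤ π := by linarith [pi_pos]
  have hcont : Continuous h := continuous_iff_continuousAt.2 fun t => (hd t).continuousAt
  set I : ℝ := ∫ t in -π..π, h t
  set J : ℝ := ∫ t in -π..π, |h' t| with hJ
  have hI0 : 0 ≤ I := intervalIntegral.integral_nonneg hπ fun t _ => h0 t
  have hpt : ∀ t ∈ Icc (-π) π, h z ≤ h t + J := fun t ht => by
    have h1 : ∫ s in t..z, h' s = h z - h t :=
      intervalIntegral.integral_eq_sub_of_hasDerivAt (fun s _ => hd s) (hc.intervalIntegrable _ _)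
    have h2 : |∫ s in t..z, h' s| ≤ J := by
      rw [hJ, intervalIntegral.integral_of_le hπ]
      refine (intervalIntegral.norm_integral_le_integral_norm_uIoc (f := h')).trans ?_
      refine setIntegral_mono_set ?_ (.of_forall fun _ => abs_nonneg _) ?_
      · exact (intervalIntegrable_iff_integrableOn_Ioc_of_le hπ).1 (hc.abs.intervalIntegrable _ _)
      · refine (Ioc_subset_Ioc ?_ ?_).eventuallyLE
        · exact le_min ht.1 hz.1
        · exact max_le ht.2 hz.2
    rw [h1] at h2
    linarith [le_abs_self (h z - h t)]
  have hint : ∫ _ in -π..π, h z ≤ ∫ t in -π..π, (h t + J) :=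
    intervalIntegral.integral_mono_on hπ (by simp)
      ((hcont.add continuous_const).intervalIntegrable _ _) hpt
  rw [intervalIntegral.integral_add (hcont.intervalIntegrable _ _) (by simp)] at hint
  simp only [intervalIntegral.integral_const, smul_eq_mul] at hint
  have hle : 2 * π * (h z - J) ≤ I := by linarith
  rcases le_total (h z - J) 0 with hneg | hpos
  · linarith
  · nlinarith [pi_gt_three]

lemma rpow_cutoff_bounds {q R r : ℝ} (hq : 2 < q) (hr : 0 < r) (hrR : r ≤ R) :
    |q * r ^ (q - 1) * (1 - r / R) ^ 3 - 3 / R * (r ^ q * (1 - r / R) ^ 2)|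
        ≤ (q + 3) * r ^ (q - 1) * (1 - r / R) ^ 2 ∧
      -((q + 3) ^ 2 * r ^ (q - 1))
        ≤ (q * r ^ (q - 1) * (1 - r / R) ^ 3 - 3 / R * (r ^ q * (1 - r / R) ^ 2))
        - r * (q * (q - 1) * r ^ (q - 2) * (1 - r / R) ^ 3
          - 6 * q / R * (r ^ (q - 1) * (1 - r / R) ^ 2) + 6 / R ^ 2 * (r ^ q * (1 - r / R))) := by
  have hR : 0 < R := hr.trans_le hrR
  have e1 : r ^ q = r ^ (q - 1) * r := by rw [← rpow_add_one hr.ne']; congr 1; ring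
  have e2 : r ^ (q - 1) = r ^ (q - 2) * r := by rw [← rpow_add_one hr.ne']; congr 1; ring
  obtain ⟨ρ, hρ⟩ : ∃ ρ, ρ = r / R := ⟨_, rfl⟩
  have hrR' : r = ρ * R := by rw [hρ]; field_simp
  have hρ0 : 0 ≤ ρ := by rw [hρ]; positivity
  have hρ1 : ρ ≤ 1 := by rw [hρ, div_le_one hR]; exact hrR
  have hY : 0 < r ^ (q - 1) := by positivity
  set Y := r ^ (q - 1)
  have f1 : 3 / R * (r ^ q * (1 - r / R) ^ 2) = Y * (3 * ρ * (1 - ρ) ^ 2) := by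
    rw [e1, hρ]; field_simp
  have f2 : r * (q * (q - 1) * r ^ (q - 2) * (1 - r / R) ^ 3
          - 6 * q / R * (Y * (1 - r / R) ^ 2) + 6 / R ^ 2 * (r ^ q * (1 - r / R)))
        = Y * (q * (q - 1) * (1 - ρ) ^ 3 - 6 * q * ρ * (1 - ρ) ^ 2 + 6 * ρ ^ 2 * (1 - ρ)) := by
    have : r * (q * (q - 1) * r ^ (q - 2) * (1 - r / R) ^ 3)
      = q * (q - 1) * Y * (1 - ρ) ^ 3 := by rw [e2, hρ]; ring
    rw [mul_add, mul_sub, this, e1, hρ]; field_simp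
  rw [f1, f2, ← hρ]
  have hχ0 : 0 ≤ 1 - ρ := by linarith
  have hχ1 : 1 - ρ ≤ 1 := by linarith
  have g2 : (1 - ρ) ^ 2 ≤ 1 := pow_le_one₀ hχ0 hχ1
  have g3 : (1 - ρ) ^ 3 ≤ (1 - ρ) ^ 2 := pow_le_pow_of_le_one hχ0 hχ1 (by norm_num)
  have g30 : 0 ≤ (1 - ρ) ^ 3 := by positivity
  have g20 : 0 ≤ (1 - ρ) ^ 2 := by positivity
  have k1 : ρ * (1 - ρ) ^ 2 ≤ (1 - ρ) ^ 2 := mul_le_of_le_one_left g20 hρ1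
  have k10 : 0 ≤ ρ * (1 - ρ) ^ 2 := by positivity
  have k2 : ρ ^ 2 * (1 - ρ) ≤ 1 := mul_le_one₀ (pow_le_one₀ hρ0 hρ1) hχ0 hχ1
  have hq0 : 0 ≤ q := by linarith
  have m1 : q * (1 - ρ) ^ 3 ≤ q * (1 - ρ) ^ 2 := mul_le_mul_of_nonneg_left g3 hq0
  have m10 : 0 ≤ q * (1 - ρ) ^ 3 := by positivity
  constructor
  · have : q * Y * (1 - ρ) ^ 3 - Y * (3 * ρ * (1 - ρ) ^ 2)
      = Y * (q * (1 - ρ) ^ 3 - 3 * (ρ * (1 - ρ) ^ 2)) := by ring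
    rw [this, abs_mul, abs_of_pos hY, mul_comm (q + 3) Y, mul_assoc]
    refine mul_le_mul_of_nonneg_left (abs_le.2 ⟨?_, ?_⟩) hY.le <;> nlinarith
  · have m2 : q * (q - 1) * (1 - ρ) ^ 3 ≤ q * (q - 1) * 1 :=
      mul_le_mul_of_nonneg_left (g3.trans g2) (mul_nonneg hq0 (by linarith))
    have m3 : 0 ≤ q * (ρ * (1 - ρ) ^ 2) := by positivity
    have : -(q + 3) ^ 2 ≤ q * (1 - ρ) ^ 3 - 3 * (ρ * (1 - ρ) ^ 2) - (q * (q - 1) * (1 - ρ) ^ 3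
      - 6 * (q * (ρ * (1 - ρ) ^ 2)) + 6 * (ρ ^ 2 * (1 - ρ))) := by nlinarith
    nlinarith [mul_le_mul_of_nonneg_left this hY.le]

section Slice

variable {q : ℝ} {f f' : ℝ → ℝ}

lemma continuous_abs_rpow {p : ℝ} (hp : 0 ≤ p) (hf : Continuous f) :
    Continuous fun z => |f z| ^ p :=
  hf.abs.rpow_const fun _ => Or.inr hp

lemma abs_rpow_eq_rpow_sub_two_mul_sq (hq : 2 < q) (x : ℝ) : |x| ^ q = |x| ^ (q - 2) * x ^ 2 := by
  rcases eq_or_ne x 0 with rfl | hx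
  · simp [zero_rpow (by linarith : q ≠ 0)]
  · rw [← sq_abs, ← rpow_add_natCast (abs_ne_zero.2 hx)]
    congr 1; push_cast; ring

lemma abs_rpow_le_integral (hq : 2 < q) (hd : ∀ z, HasDerivAt f (f' z) z) (hc : Continuous f')
    {z : ℝ} (hz : z ∈ Icc (-π) π) :
    |f z| ^ q ≤ (∫ t in -π..π, |f t| ^ q)
      + ∫ t in -π..π, q * (|f t| ^ (q - 2) * |f t| * |f' t|) := by
  have hcont : Continuous f := continuous_iff_continuousAt.2 fun t => (hd t).continuousAt
  have := le_integral_add_integral_abs_deriv (h := fun z => |f z| ^ q)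
    (h' := fun z => q * |f z| ^ (q - 2) * f z * f' z)
    (fun z => (hasDerivAt_abs_rpow (f z) (by linarith)).comp z (hd z))
    (((continuous_const.mul (continuous_abs_rpow (by linarith) hcont)).mul hcont).mul hc)
    (fun z => rpow_nonneg (abs_nonneg _) _) hz
  refine this.trans_eq ?_
  congr 1
  refine intervalIntegral.integral_congr fun t _ => ?_
  rw [abs_mul, abs_mul, abs_mul, abs_of_nonneg (by linarith : 0 ≤ q),
    abs_of_nonneg (rpow_nonneg (abs_nonneg (f t)) _)]
  ring

lemma integral_cross_le {C χ : ℝ} (hq : 2 < q) (hχ : χ ∈ Icc (0 : ℝ) 1)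
    (hf : Continuous f) (hf' : Continuous f') :
    C * χ ^ 2 * ∫ t in -π..π, q * (|f t| ^ (q - 2) * |f t| * |f' t|)
      ≤ C ^ 2 * q / (2 * (q - 1)) * (∫ t in -π..π, |f t| ^ q)
        + q * (q - 1) / 2 * χ ^ 3 * ∫ t in -π..π, |f t| ^ (q - 2) * f' t ^ 2 := by
  have hn := continuous_abs_rpow (p := q - 2) (by linarith) hf
  have hN := continuous_abs_rpow (p := q) (by linarith) hf
  have h1 : Continuous fun t => C * χ ^ 2 * (q * (|f t| ^ (q - 2) * |f t| * |f' t|)) :=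
    continuous_const.mul (continuous_const.mul ((hn.mul hf.abs).mul hf'.abs))
  have h2 : Continuous fun t => C ^ 2 * q / (2 * (q - 1)) * |f t| ^ q := continuous_const.mul hN
  have h3 : Continuous fun t => q * (q - 1) / 2 * χ ^ 3 * (|f t| ^ (q - 2) * f' t ^ 2) :=
    continuous_const.mul (hn.mul (hf'.pow 2))
  simp only [← intervalIntegral.integral_const_mul]
  rw [← intervalIntegral.integral_add (h2.intervalIntegrable _ _) (h3.intervalIntegrable _ _)]
  refine intervalIntegral.integral_mono_on (by linarith [pi_pos]) (h1.intervalIntegrable _ _)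
    ((h2.add h3).intervalIntegrable _ _) fun t _ => ?_
  rw [abs_rpow_eq_rpow_sub_two_mul_sq hq, ← sq_abs (f t), ← sq_abs (f' t)]
  have hn0 : 0 ≤ |f t| ^ (q - 2) := rpow_nonneg (abs_nonneg _) _
  set n := |f t| ^ (q - 2)
  set x := |f t|
  set y := |f' t|
  have hq1 : 0 < q - 1 := by linarith
  have hsq : C * χ ^ 2 * (q * (x * y))
      ≤ χ * (C ^ 2 * q / (2 * (q - 1)) * x ^ 2) + q * (q - 1) / 2 * χ ^ 3 * y ^ 2 := by
    have : 0 ≤ χ * (q / (2 * (q - 1))) * (C * x - (q - 1) * χ * y) ^ 2 := by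
      have := hχ.1; positivity
    refine le_of_sub_nonneg (this.trans_eq ?_)
    field_simp
    ring
  have hle : χ * (C ^ 2 * q / (2 * (q - 1)) * x ^ 2) ≤ C ^ 2 * q / (2 * (q - 1)) * x ^ 2 :=
    mul_le_of_le_one_left (by positivity) hχ.2
  have := mul_le_mul_of_nonneg_left (hsq.trans (add_le_add_left hle _)) hn0
  linarith

/-- The drift term is controlled by the dissipation and the `L^q` norm on a slice. -/
lemma integral_drift_le {C χ A : ℝ} {u : ℝ → ℝ} (hq : 2 < q) (hχ : χ ∈ Icc (0 : ℝ) 1) (hC : 0 ≤ C)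
    (hd : ∀ z, HasDerivAt f (f' z) z) (hf' : Continuous f') (hu : Continuous u)
    (hA0 : 0 ≤ A) (hA : ∫ t in -π..π, |u t| ≤ C * A) :
    χ ^ 2 * ∫ t in -π..π, |u t| * |f t| ^ q
      ≤ A * ((C + C ^ 2 * q / (2 * (q - 1))) * (∫ t in -π..π, |f t| ^ q)
        + q * (q - 1) / 2 * χ ^ 3 * ∫ t in -π..π, |f t| ^ (q - 2) * f' t ^ 2) := by
  have hπ : -π ≤ π := by linarith [pi_pos]
  have hf : Continuous f := continuous_iff_continuousAt.2 fun t => (hd t).continuousAt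
  have hN := continuous_abs_rpow (p := q) (by linarith) hf
  have hcross := integral_cross_le (C := C) hq hχ hf hf'
  set H := ∫ t in -π..π, |f t| ^ q with hH
  set L := ∫ t in -π..π, q * (|f t| ^ (q - 2) * |f t| * |f' t|) with hL
  have hH0 : 0 ≤ H := intervalIntegral.integral_nonneg hπ fun t _ => rpow_nonneg (abs_nonneg _) _
  have hL0 : 0 ≤ L := intervalIntegral.integral_nonneg hπ fun t _ => by positivity
  have h1 : ∫ t in -π..π, |u t| * |f t| ^ q ≤ (∫ t in -π..π, |u t|) * (H + L) := by
    rw [← intervalIntegral.integral_mul_const]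
    exact intervalIntegral.integral_mono_on hπ ((hu.abs.mul hN).intervalIntegrable _ _)
      ((hu.abs.mul continuous_const).intervalIntegrable _ _) fun t ht =>
        mul_le_mul_of_nonneg_left (abs_rpow_le_integral hq hd hf' ht) (abs_nonneg _)
  have h2 : ∫ t in -π..π, |u t| * |f t| ^ q ≤ C * A * (H + L) :=
    h1.trans (mul_le_mul_of_nonneg_right hA (by positivity))
  have h3 := mul_le_mul_of_nonneg_left h2 (sq_nonneg χ)
  have h4 : C * χ ^ 2 * H ≤ C * H :=
    mul_le_mul_of_nonneg_right (mul_le_of_le_one_right hC (pow_le_one₀ hχ.1 hχ.2)) hH0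
  have h5 := mul_le_mul_of_nonneg_left (add_le_add h4 hcross) hA0
  linarith

end Slice

lemma le_integral_energy_slice {q C b r χ φ₁ e : ℝ} {f f' g u : ℝ → ℝ} (hq : 2 < q) (hb : 0 < b)
    (hbr : b ≤ r) (hχ : χ ∈ Icc (0 : ℝ) 1) (hC : 0 ≤ C)
    (hφ₁ : |φ₁| ≤ (q + 3) * r ^ (q - 1) * χ ^ 2) (he : -((q + 3) ^ 2 * r ^ (q - 1)) ≤ e)
    (hd : ∀ z, HasDerivAt f (f' z) z) (hf' : Continuous f') (hg : Continuous g)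
    (hu : Continuous u) (hCu : ∫ z in -π..π, |u z| ≤ C * r) :
    q * (q - 1) / 2 * (r ^ (q + 1) * (χ ^ 3 * ∫ z in -π..π, |f z| ^ (q - 2) * f' z ^ 2))
      ≤ (∫ z in -π..π, (r ^ q * χ ^ 3 * r * (q * (q - 1) * |f z| ^ (q - 2) * (g z ^ 2 + f' z ^ 2))
          + (e - φ₁ * r * u z) * |f z| ^ q))
        + ((q + 3) ^ 2 / b ^ 2 + (q + 3) * C + ((q + 3) * C) ^ 2 * q / (2 * (q - 1)))
          * (r ^ (q + 1) * ∫ z in -π..π, |f z| ^ q) := by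
  have hπ : -π ≤ π := by linarith [pi_pos]
  have hq1 : 0 < q - 1 := by linarith
  have hr0 : 0 < r := hb.trans_le hbr
  have hf : Continuous f := continuous_iff_continuousAt.2 fun t => (hd t).continuousAt
  have sn : Continuous fun z => |f z| ^ (q - 2) := continuous_abs_rpow (by linarith) hf
  have sh : Continuous fun z => |f z| ^ q := continuous_abs_rpow (by linarith) hf
  have sk : Continuous fun z => |f z| ^ (q - 2) * f' z ^ 2 := sn.mul (hf'.pow 2)
  set D : ℝ := (q + 3) * C with hD
  have hdrift := integral_drift_le (C := D) (A := r / (q + 3)) hq hχ (by positivity)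
    hd hf' hu (by positivity) (hCu.trans_eq (by rw [hD]; field_simp))
  have e1 : r ^ (q + 1) = r ^ q * r := rpow_add_one hr0.ne' q
  have e2 : r ^ q = r ^ (q - 1) * r := by rw [← rpow_add_one hr0.ne']; congr 1; ring
  have hrb : r ^ (q - 1) ≤ r ^ (q + 1) / b ^ 2 := by
    rw [le_div_iff₀ (by positivity), e1, e2, mul_assoc, ← pow_two]
    gcongr
  have s1 : Continuous fun z => q * (q - 1) * (r ^ (q + 1) * χ ^ 3)
      * (|f z| ^ (q - 2) * f' z ^ 2) := continuous_const.mul sk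
  have s2 : Continuous fun z => (q + 3) ^ 2 / b ^ 2 * r ^ (q + 1) * |f z| ^ q :=
    continuous_const.mul sh
  have s12 : Continuous fun z => q * (q - 1) * (r ^ (q + 1) * χ ^ 3)
      * (|f z| ^ (q - 2) * f' z ^ 2) - (q + 3) ^ 2 / b ^ 2 * r ^ (q + 1) * |f z| ^ q := s1.sub s2
  have s3 : Continuous fun z => (q + 3) * r ^ q * χ ^ 2 * (|u z| * |f z| ^ q) :=
    continuous_const.mul (hu.abs.mul sh)
  have hlow : ∫ z in -π..π, (q * (q - 1) * (r ^ (q + 1) * χ ^ 3) * (|f z| ^ (q - 2) * f' z ^ 2)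
      - (q + 3) ^ 2 / b ^ 2 * r ^ (q + 1) * |f z| ^ q
      - (q + 3) * r ^ q * χ ^ 2 * (|u z| * |f z| ^ q))
      ≤ ∫ z in -π..π, (r ^ q * χ ^ 3 * r * (q * (q - 1) * |f z| ^ (q - 2) * (g z ^ 2 + f' z ^ 2))
          + (e - φ₁ * r * u z) * |f z| ^ q) := by
    refine intervalIntegral.integral_mono_on hπ ((s12.sub s3).intervalIntegrable _ _)
      (Continuous.intervalIntegrable (by fun_prop) _ _) fun z _ => ?_
    have hN0 : 0 ≤ |f z| ^ q := by positivity
    have hn0 : 0 ≤ |f z| ^ (q - 2) := by positivity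
    have t1 : 0 ≤ q * (q - 1) * (r ^ (q + 1) * χ ^ 3) * (|f z| ^ (q - 2) * g z ^ 2) := by
      have := hχ.1; positivity
    have t2 : -((q + 3) ^ 2 / b ^ 2 * r ^ (q + 1)) * |f z| ^ q ≤ e * |f z| ^ q := by
      refine mul_le_mul_of_nonneg_right (le_trans ?_ he) hN0
      rw [neg_le_neg_iff, div_mul_eq_mul_div, mul_div_assoc]
      exact mul_le_mul_of_nonneg_left hrb (by positivity)
    have t3 : φ₁ * r * u z * |f z| ^ q ≤ (q + 3) * r ^ q * χ ^ 2 * (|u z| * |f z| ^ q) := by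
      rw [← mul_assoc _ |u z|]
      refine mul_le_mul_of_nonneg_right ?_ hN0
      calc φ₁ * r * u z ≤ |φ₁ * r * u z| := le_abs_self _
        _ = |φ₁| * r * |u z| := by rw [abs_mul, abs_mul, abs_of_pos hr0]
        _ ≤ (q + 3) * r ^ (q - 1) * χ ^ 2 * r * |u z| := by gcongr
        _ = _ := by rw [e2]; ring
    rw [e1] at t1 t2 ⊢
    linarith
  rw [intervalIntegral.integral_sub (s12.intervalIntegrable _ _)
    (s3.intervalIntegrable _ _), intervalIntegral.integral_sub (s1.intervalIntegrable _ _)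
    (s2.intervalIntegrable _ _), intervalIntegral.integral_const_mul,
    intervalIntegral.integral_const_mul, intervalIntegral.integral_const_mul] at hlow
  have hd' := mul_le_mul_of_nonneg_left hdrift (by positivity : 0 ≤ (q + 3) * r ^ q)
  set H := ∫ z in -π..π, |f z| ^ q
  set K := ∫ z in -π..π, |f z| ^ (q - 2) * f' z ^ 2
  have e3 : (q + 3) * r ^ q * (r / (q + 3) * ((D + D ^ 2 * q / (2 * (q - 1))) * H
      + q * (q - 1) / 2 * χ ^ 3 * K)) = r ^ (q + 1) * ((D + D ^ 2 * q / (2 * (q - 1))) * H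
      + q * (q - 1) / 2 * χ ^ 3 * K) := by rw [e1]; field_simp
  have hd'' := hd'.trans_eq e3
  linarith

lemma neg_integral_boundary_le {q b φ₀ φ₁ B₀ B₁ : ℝ} {f g u : ℝ → ℝ} (hq : 2 < q) (hb : 0 < b)
    (hB₀ : 0 ≤ B₀) (hφ₀ : |φ₀| ≤ B₀) (hφ₁ : |φ₁| ≤ B₁) (hf : Continuous f)
    (hg : Continuous g) (hu : Continuous u) :
    -(∫ z in -π..π, (φ₀ * (b * (q * (|f z| ^ (q - 2) * f z) * g z) + (2 - b * u z) * |f z| ^ q)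
      - b * φ₁ * |f z| ^ q))
    ≤ ∫ z in -π..π, (B₀ * (b * (q * (|f z| ^ (q - 2) * |f z|) * |g z|) + |2 - b * u z| * |f z| ^ q)
      + b * B₁ * |f z| ^ q) := by
  have sn : Continuous fun z => |f z| ^ (q - 2) := continuous_abs_rpow (by linarith) hf
  have sh : Continuous fun z => |f z| ^ q := continuous_abs_rpow (by linarith) hf
  have hq2 : 0 ≤ q - 2 := by linarith
  have hq0 : 0 ≤ q := by linarith
  rw [← intervalIntegral.integral_neg]
  refine intervalIntegral.integral_mono_on (by linarith [pi_pos])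
    (Continuous.intervalIntegrable (by fun_prop) _ _)
    (Continuous.intervalIntegrable (by fun_prop) _ _) fun z _ => ?_
  refine (neg_le_abs _).trans ((abs_sub _ _).trans ?_)
  have hN0 : 0 ≤ |f z| ^ q := by positivity
  have hn0 : 0 ≤ |f z| ^ (q - 2) := by positivity
  refine add_le_add ?_ ?_
  · rw [abs_mul]
    refine mul_le_mul hφ₀ ((abs_add_le _ _).trans_eq ?_) (abs_nonneg _) hB₀
    simp only [abs_mul, abs_of_pos hb, abs_of_nonneg hN0, abs_of_nonneg hn0, abs_of_nonneg hq0]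
  · rw [abs_mul, abs_mul, abs_of_pos hb, abs_of_nonneg hN0]
    gcongr

/-- Weighted bound for the vertical dissipation of `Ω`. -/
lemma exists_dissipation_le {a b q C M : ℝ} (ha : 0 ≤ a) (hab : a < b) (hq : 2 < q)
    {u w Ω : ℝ × ℝ → ℝ} (hu : SmoothRight a u) (hw : SmoothRight a w) (hΩ : SmoothRight a Ω)
    (hwper : ∀ r z, w (r, z + 2 * π) = w (r, z)) (hΩper : ∀ r z, Ω (r, z + 2 * π) = Ω (r, z))
    (hdiv : ∀ p : ℝ × ℝ, a < p.1 → partialR u p + u p * p.1⁻¹ + partialZ w p = 0)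
    (heq : ∀ p : ℝ × ℝ, a < p.1 → u p * partialR Ω p + w p * partialZ Ω p
      = partialR (partialR Ω) p + 3 / p.1 * partialR Ω p + partialZ (partialZ Ω) p)
    (hC : 0 ≤ C) (hCu : ∀ r, b ≤ r → ∫ z in -π..π, |u (r, z)| ≤ C * r)
    (hM : ∀ R, b ≤ R → ∫ r in b..R, r ^ (q + 1) * ∫ z in -π..π, |Ω (r, z)| ^ q ≤ M) :
    ∃ M', ∀ R, b ≤ R → ∫ r in b..R,
      r ^ (q + 1) * ∫ z in -π..π, |Ω (r, z)| ^ (q - 2) * partialZ Ω (r, z) ^ 2 ≤ M' := by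
  have hb : 0 < b := ha.trans_lt hab
  have hπ : -π ≤ π := by linarith [pi_pos]
  have hq1 : 0 < q - 1 := by linarith
  have cn : ContinuousOn (fun p => |Ω p| ^ (q - 2)) (halfPlane a) :=
    hΩ.continuousOn.abs.rpow_const fun _ _ => Or.inr (by linarith)
  have ch : ContinuousOn (fun p => |Ω p| ^ q) (halfPlane a) :=
    hΩ.continuousOn.abs.rpow_const fun _ _ => Or.inr (by linarith)
  have ck : ContinuousOn (fun p => |Ω p| ^ (q - 2) * partialZ Ω p ^ 2) (halfPlane a) :=
    cn.mul (hΩ.partialZ.continuousOn.pow 2)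
  set H : ℝ → ℝ := fun r => ∫ z in -π..π, |Ω (r, z)| ^ q with hH
  set K : ℝ → ℝ := fun r => ∫ z in -π..π, |Ω (r, z)| ^ (q - 2) * partialZ Ω (r, z) ^ 2 with hK
  have cH : ContinuousOn H (Ici b) := continuousOn_integral_snd hab ch
  have cK : ContinuousOn K (Ici b) := continuousOn_integral_snd hab ck
  have hK0 : ∀ r, 0 ≤ K r := fun r => intervalIntegral.integral_nonneg hπ fun z _ => by positivity
  have cpow : ∀ s : ℝ, ContinuousOn (fun r : ℝ => r ^ s) (Ioi a) := fun s r hr =>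
    (continuousAt_rpow_const r s (Or.inl (ha.trans_lt hr).ne')).continuousWithinAt
  have hIci : Ici b ⊆ Ioi a := fun r hr => hab.trans_le hr
  set D : ℝ := (q + 3) * C with hD
  set C₄ : ℝ := (q + 3) ^ 2 / b ^ 2 + D + D ^ 2 * q / (2 * (q - 1)) with hC₄
  set B : ℝ → ℝ := fun z => b ^ q * (b * (q * (|Ω (b, z)| ^ (q - 2) * |Ω (b, z)|)
    * |partialR Ω (b, z)|) + |2 - b * u (b, z)| * |Ω (b, z)| ^ q)
    + b * ((q + 3) * b ^ (q - 1)) * |Ω (b, z)| ^ q with hB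
  refine ⟨16 / (q * (q - 1)) * ((∫ z in -π..π, B z) + C₄ * M), fun R₀ hR₀ => ?_⟩
  obtain ⟨R, hR⟩ : ∃ R, R = 2 * R₀ := ⟨_, rfl⟩
  have hbR : b ≤ R := by linarith
  have hR0 : 0 < R := hb.trans_le hbR
  set χ : ℝ → ℝ := fun r => 1 - r / R with hχ
  have hχ1 : ∀ r, HasDerivAt χ (-(1 / R)) r := fun r =>
    ((hasDerivAt_id r).div_const R).const_sub 1
  have cχ : Continuous χ := by fun_prop
  have hχI : ∀ r ∈ Icc b R, χ r ∈ Icc (0 : ℝ) 1 := fun r hr => by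
    have h1 : r / R ≤ 1 := (div_le_one hR0).2 hr.2
    have h2 : 0 ≤ r / R := div_nonneg (hb.le.trans hr.1) hR0.le
    exact ⟨by simp only [hχ]; linarith, by simp only [hχ]; linarith⟩
  set φ : ℝ → ℝ := fun r => r ^ q * χ r ^ 3 with hφ
  set φ' : ℝ → ℝ := fun r => q * r ^ (q - 1) * χ r ^ 3 - 3 / R * (r ^ q * χ r ^ 2) with hφ'
  set φ'' : ℝ → ℝ := fun r => q * (q - 1) * r ^ (q - 2) * χ r ^ 3
    - 6 * q / R * (r ^ (q - 1) * χ r ^ 2) + 6 / R ^ 2 * (r ^ q * χ r) with hφ''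
  have hpow : ∀ s r : ℝ, a < r → HasDerivAt (fun r => r ^ s) (s * r ^ (s - 1)) r := fun s r hr =>
    hasDerivAt_rpow_const (Or.inl (ha.trans_lt hr).ne')
  have dφ : ∀ r, a < r → HasDerivAt φ (φ' r) r := fun r hr => by
    refine ((hpow q r hr).mul ((hχ1 r).pow 3)).congr_deriv ?_
    simp only [hφ', Pi.pow_apply]; push_cast; ring
  have dφ' : ∀ r, a < r → HasDerivAt φ' (φ'' r) r := fun r hr => by
    refine ((((hpow (q - 1) r hr).const_mul q).mul ((hχ1 r).pow 3)).sub
      (((hpow q r hr).mul ((hχ1 r).pow 2)).const_mul (3 / R))).congr_deriv ?_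
    have : q - 1 - 1 = q - 2 := by ring
    simp only [hφ'', this, Pi.pow_apply]; push_cast; field_simp; ring
  have cφ'' : ContinuousOn φ'' (Ioi a) := by
    have h1 := cpow q
    have h2 := cpow (q - 1)
    have h3 := cpow (q - 2)
    fun_prop
  have cφ : ContinuousOn φ (Ioi a) := fun r hr => (dφ r hr).continuousAt.continuousWithinAt
  have cφ' : ContinuousOn φ' (Ioi a) := fun r hr => (dφ' r hr).continuousAt.continuousWithinAt
  have hbounds : ∀ r ∈ Icc b R, |φ' r| ≤ (q + 3) * r ^ (q - 1) * χ r ^ 2 ∧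
      -((q + 3) ^ 2 * r ^ (q - 1)) ≤ φ' r - r * φ'' r := fun r hr =>
    rpow_cutoff_bounds hq (hb.trans_le hr.1) hr.2
  have hen := energy_identity ha hab hbR hq hu hw hΩ hwper hΩper hdiv heq dφ dφ' cφ''
  set I : ℝ → ℝ := fun r => ∫ z in -π..π, (φ r * r * (q * (q - 1) * |Ω (r, z)| ^ (q - 2)
      * (partialR Ω (r, z) ^ 2 + partialZ Ω (r, z) ^ 2))
    + (φ' r - r * φ'' r - φ' r * r * u (r, z)) * |Ω (r, z)| ^ q) with hI
  have hfst : MapsTo Prod.fst (halfPlane a) (Ioi a) := fun p hp => hp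
  have cE : ContinuousOn (fun p : ℝ × ℝ => φ p.1 * p.1 * (q * (q - 1) * |Ω p| ^ (q - 2)
      * (partialR Ω p ^ 2 + partialZ Ω p ^ 2))
      + (φ' p.1 - p.1 * φ'' p.1 - φ' p.1 * p.1 * u p) * |Ω p| ^ q) (halfPlane a) := by
    have h1 := cφ.comp continuousOn_fst hfst
    have h2 := cφ'.comp continuousOn_fst hfst
    have h3 := cφ''.comp continuousOn_fst hfst
    exact ((h1.mul continuousOn_fst).mul ((continuousOn_const.mul cn).mul
      ((hΩ.partialR.continuousOn.pow 2).add (hΩ.partialZ.continuousOn.pow 2)))).add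
      (((h2.sub (continuousOn_fst.mul h3)).sub
        ((h2.mul continuousOn_fst).mul hu.continuousOn)).mul ch)
  have cI : ContinuousOn I (Ici b) := continuousOn_integral_snd hab cE
  have hslice : ∀ r ∈ Icc b R, q * (q - 1) / 2 * (r ^ (q + 1) * (χ r ^ 3 * K r))
      ≤ I r + C₄ * (r ^ (q + 1) * H r) := fun r hr => by
    have har : a < r := hab.trans_le hr.1
    exact le_integral_energy_slice hq hb hr.1 (hχI r hr) hC (hbounds r hr).1 (hbounds r hr).2
      (fun z => hΩ.hasDerivAt_snd (z := z) har) (continuous_slice har hΩ.partialZ.continuousOn)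
      (continuous_slice har hΩ.partialR.continuousOn) (continuous_slice har hu.continuousOn)
      (hCu r hr.1)
  have hFR : (∫ z in -π..π, (φ R * (R * (q * (|Ω (R, z)| ^ (q - 2) * Ω (R, z))
      * partialR Ω (R, z)) + (2 - R * u (R, z)) * |Ω (R, z)| ^ q)
      - R * φ' R * |Ω (R, z)| ^ q)) = 0 := by
    have h0 : χ R = 0 := by simp [hχ, hR0.ne']
    simp [hφ, hφ', h0]
  have hFb : -(∫ z in -π..π, (φ b * (b * (q * (|Ω (b, z)| ^ (q - 2) * Ω (b, z))
      * partialR Ω (b, z)) + (2 - b * u (b, z)) * |Ω (b, z)| ^ q)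
      - b * φ' b * |Ω (b, z)| ^ q)) ≤ ∫ z in -π..π, B z := by
    have hχb := hχI b ⟨le_rfl, hbR⟩
    have hφ0 : |φ b| ≤ b ^ q := by
      simp only [hφ]
      rw [abs_of_nonneg (mul_nonneg (by positivity) (pow_nonneg hχb.1 3))]
      exact mul_le_of_le_one_right (by positivity) (pow_le_one₀ hχb.1 hχb.2)
    have hφ1 : |φ' b| ≤ (q + 3) * b ^ (q - 1) :=
      (hbounds b ⟨le_rfl, hbR⟩).1.trans
        (mul_le_of_le_one_right (by positivity) (pow_le_one₀ hχb.1 hχb.2))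
    exact neg_integral_boundary_le hq hb (by positivity) hφ0 hφ1
      (continuous_slice hab hΩ.continuousOn) (continuous_slice hab hΩ.partialR.continuousOn)
      (continuous_slice hab hu.continuousOn)
  have cp : ContinuousOn (fun r : ℝ => r ^ (q + 1)) (Ici b) := (cpow (q + 1)).mono hIci
  have i1 := intervalIntegrable_of_continuousOn_Ici (cp.mul cK) le_rfl hR₀
  have cχK : ContinuousOn (fun r => r ^ (q + 1) * (χ r ^ 3 * K r)) (Ici b) :=
    cp.mul ((cχ.pow 3).continuousOn.mul cK)
  have cpH : ContinuousOn (fun r => r ^ (q + 1) * H r) (Ici b) := cp.mul cH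
  have j1 : ∫ r in b..R₀, r ^ (q + 1) * K r
      ≤ ∫ r in b..R₀, 8 * (r ^ (q + 1) * (χ r ^ 3 * K r)) := by
    refine intervalIntegral.integral_mono_on hR₀ i1
      ((intervalIntegrable_of_continuousOn_Ici cχK le_rfl hR₀).const_mul 8) fun r hr => ?_
    have h1 : 1 / 2 ≤ χ r := by
      have : r / R ≤ 1 / 2 := by
        rw [div_le_div_iff₀ hR0 two_pos]; linarith [hr.2]
      simp only [hχ]; linarith
    have h2 : (1 / 2) ^ 3 ≤ χ r ^ 3 := pow_le_pow_left₀ (by norm_num) h1 3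
    have h3 : 0 ≤ r ^ (q + 1) * K r :=
      mul_nonneg (rpow_nonneg (hb.le.trans hr.1) _) (hK0 r)
    nlinarith [mul_le_mul_of_nonneg_left h2 h3]
  have j2 : ∫ r in b..R₀, r ^ (q + 1) * (χ r ^ 3 * K r)
      ≤ ∫ r in b..R, r ^ (q + 1) * (χ r ^ 3 * K r) := by
    rw [← intervalIntegral.integral_add_adjacent_intervals
      (intervalIntegrable_of_continuousOn_Ici cχK le_rfl hR₀)
      (intervalIntegrable_of_continuousOn_Ici cχK hR₀ hbR)]
    refine le_add_of_nonneg_right (intervalIntegral.integral_nonneg (by linarith) fun r hr => ?_)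
    exact mul_nonneg (rpow_nonneg (by linarith [hr.1]) _)
      (mul_nonneg (pow_nonneg (hχI r ⟨by linarith [hr.1], hr.2⟩).1 3) (hK0 r))
  have j3 : ∫ r in b..R, q * (q - 1) / 2 * (r ^ (q + 1) * (χ r ^ 3 * K r))
      ≤ ∫ r in b..R, (I r + C₄ * (r ^ (q + 1) * H r)) :=
    intervalIntegral.integral_mono_on hbR
      ((intervalIntegrable_of_continuousOn_Ici cχK le_rfl hbR).const_mul _)
      ((intervalIntegrable_of_continuousOn_Ici cI le_rfl hbR).add
        ((intervalIntegrable_of_continuousOn_Ici cpH le_rfl hbR).const_mul _)) hslice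
  rw [intervalIntegral.integral_add (intervalIntegrable_of_continuousOn_Ici cI le_rfl hbR)
    ((intervalIntegrable_of_continuousOn_Ici cpH le_rfl hbR).const_mul _),
    intervalIntegral.integral_const_mul, intervalIntegral.integral_const_mul] at j3
  rw [intervalIntegral.integral_const_mul] at j1
  have hC₄0 : 0 ≤ C₄ := by positivity
  have j4 := mul_le_mul_of_nonneg_left (hM R hbR) hC₄0
  have j5 : ∫ r in b..R, I r ≤ ∫ z in -π..π, B z := by
    refine hen.trans_le ?_
    rw [hFR, zero_sub]
    exact hFb
  have j6 : q * (q - 1) / 2 * (∫ r in b..R, r ^ (q + 1) * (χ r ^ 3 * K r))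
      ≤ (∫ z in -π..π, B z) + C₄ * M := by linarith
  have hqq : 0 < q * (q - 1) := by positivity
  rw [div_mul_eq_mul_div, le_div_iff₀ hqq]
  have j7 : ∫ r in b..R₀, r ^ (q + 1) * K r
      ≤ 8 * ∫ r in b..R, r ^ (q + 1) * (χ r ^ 3 * K r) := by linarith
  have j8 := mul_le_mul_of_nonneg_left j7 hqq.le
  linarith

lemma eventually_exists_mul_le {b M ε : ℝ} {f : ℝ → ℝ} (hb : 0 < b)
    (hc : ContinuousOn f (Ici b)) (h0 : ∀ r, b ≤ r → 0 ≤ f r)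
    (hM : ∀ R, b ≤ R → ∫ r in b..R, f r ≤ M) (hε : 0 < ε) :
    ∀ᶠ R in atTop, ∃ r ∈ Icc R (2 * R), R * f r ≤ ε := by
  set S : Set ℝ := (fun R => ∫ r in b..R, f r) '' Ici b with hS
  have hbdd : BddAbove S := ⟨M, by rintro _ ⟨R, hR, rfl⟩; exact hM R hR⟩
  obtain ⟨_, ⟨R₀, hR₀, rfl⟩, hlt⟩ := exists_lt_of_lt_csSup (s := S) ⟨_, b, self_mem_Ici, rfl⟩
    (sub_lt_self (sSup S) hε)
  have hR₀ : b ≤ R₀ := hR₀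
  filter_upwards [eventually_ge_atTop R₀] with R hR
  have hbR : b ≤ R := hR₀.trans hR
  have hR2 : R ≤ 2 * R := by linarith
  have hsub : Icc R (2 * R) ⊆ Ici b := fun r hr => hbR.trans hr.1
  obtain ⟨r, hr, hmin⟩ := isCompact_Icc.exists_isMinOn ⟨R, le_rfl, hR2⟩ (hc.mono hsub)
  refine ⟨r, hr, ?_⟩
  have h1 : ∫ _ in R..2 * R, f r ≤ ∫ s in R..2 * R, f s :=
    intervalIntegral.integral_mono_on hR2 (by simp)
      (intervalIntegrable_of_continuousOn_Ici hc hbR (hbR.trans hR2)) fun s hs => hmin hs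
  have h2 : ∫ s in R..2 * R, f s = (∫ s in b..2 * R, f s) - ∫ s in b..R, f s :=
    (intervalIntegral.integral_interval_sub_left
      (intervalIntegrable_of_continuousOn_Ici hc le_rfl (hbR.trans hR2))
      (intervalIntegrable_of_continuousOn_Ici hc le_rfl hbR)).symm
  have h3 : ∫ s in b..2 * R, f s ≤ sSup S := le_csSup hbdd ⟨2 * R, hbR.trans hR2, rfl⟩
  have h4 : ∫ s in b..R₀, f s ≤ ∫ s in b..R, f s := by
    rw [← intervalIntegral.integral_add_adjacent_intervals
      (intervalIntegrable_of_continuousOn_Ici hc le_rfl hR₀)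
      (intervalIntegrable_of_continuousOn_Ici hc hR₀ hbR)]
    exact le_add_of_nonneg_right (intervalIntegral.integral_nonneg hR fun s hs =>
      h0 s (hR₀.trans hs.1))
  simp only [intervalIntegral.integral_const, smul_eq_mul] at h1
  linarith

/-- Pointwise decay of `Ω` under planar weighted integral bounds. -/
lemma eventually_rpow_mul_le {a b q M ε : ℝ} (ha : 0 ≤ a) (hab : a < b) (hq : 2 < q)
    {u w Ω : ℝ × ℝ → ℝ} (hu : SmoothRight a u) (hw : SmoothRight a w) (hΩ : SmoothRight a Ω)
    (hwper : ∀ r z, w (r, z + 2 * π) = w (r, z)) (hΩper : ∀ r z, Ω (r, z + 2 * π) = Ω (r, z))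
    (hdiv : ∀ p : ℝ × ℝ, a < p.1 → partialR u p + u p * p.1⁻¹ + partialZ w p = 0)
    (heq : ∀ p : ℝ × ℝ, a < p.1 → u p * partialR Ω p + w p * partialZ Ω p
      = partialR (partialR Ω) p + 3 / p.1 * partialR Ω p + partialZ (partialZ Ω) p)
    (hMu : ∀ R, b ≤ R → ∫ r in b..R, ∫ z in -π..π, r * |partialR u (r, z)| ^ q ≤ M)
    (hMΩ : ∀ R, b ≤ R → ∫ r in b..R, r ^ (q + 1) * ∫ z in -π..π, |Ω (r, z)| ^ q ≤ M)
    (hε : 0 < ε) : ∀ᶠ r in atTop, ∀ z, r ^ (q + 2) * |Ω (r, z)| ^ q ≤ ε := by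
  have hb : 0 < b := ha.trans_lt hab
  have hπ : -π ≤ π := by linarith [pi_pos]
  have hq0 : 0 < q := by linarith
  have hq1 : 0 < q - 1 := by linarith
  obtain ⟨C, hC, hCu⟩ := exists_integral_abs_le ha hab (by linarith) hu hMu
  obtain ⟨M', hM'⟩ :=
    exists_dissipation_le ha hab hq hu hw hΩ hwper hΩper hdiv heq hC hCu hMΩ
  have cn : ContinuousOn (fun p => |Ω p| ^ (q - 2)) (halfPlane a) :=
    hΩ.continuousOn.abs.rpow_const fun _ _ => Or.inr (by linarith)
  have ch : ContinuousOn (fun p => |Ω p| ^ q) (halfPlane a) :=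
    hΩ.continuousOn.abs.rpow_const fun _ _ => Or.inr (by linarith)
  have ck : ContinuousOn (fun p => |Ω p| ^ (q - 2) * partialZ Ω p ^ 2) (halfPlane a) :=
    cn.mul (hΩ.partialZ.continuousOn.pow 2)
  set H : ℝ → ℝ := fun r => ∫ z in -π..π, |Ω (r, z)| ^ q with hH
  set K : ℝ → ℝ := fun r => ∫ z in -π..π, |Ω (r, z)| ^ (q - 2) * partialZ Ω (r, z) ^ 2 with hK
  have hH0 : ∀ r, 0 ≤ H r := fun r => intervalIntegral.integral_nonneg hπ fun z _ => by positivity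
  have hK0 : ∀ r, 0 ≤ K r := fun r => intervalIntegral.integral_nonneg hπ fun z _ => by positivity
  have cp : ContinuousOn (fun r : ℝ => r ^ (q + 1)) (Ici b) := fun r hr =>
    (continuousAt_rpow_const r _ (Or.inr (by linarith))).continuousWithinAt
  have cH : ContinuousOn (fun r => r ^ (q + 1) * H r) (Ici b) :=
    cp.mul (continuousOn_integral_snd hab ch)
  have cK : ContinuousOn (fun r => r ^ (q + 1) * K r) (Ici b) :=
    cp.mul (continuousOn_integral_snd hab ck)
  set c : ℝ := 1 + q / (2 * (q - 1)) + q * (q - 1) / 2 with hc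
  have hc0 : 0 < c := by positivity
  have hsup : ∀ r, b ≤ r → ∀ z, |Ω (r, z)| ^ q ≤ c * (H r + K r) := fun r hr z => by
    have har : a < r := hab.trans_le hr
    obtain ⟨y, hy, hzy⟩ := exists_mem_Icc_neg_pi_pi (f := fun z => Ω (r, z)) (hΩper r) z
    rw [hzy]
    have h1 := abs_rpow_le_integral hq (fun z => hΩ.hasDerivAt_snd (z := z) har)
      (continuous_slice har hΩ.partialZ.continuousOn) hy
    have h2 := integral_cross_le (C := 1) (χ := 1) hq ⟨zero_le_one, le_rfl⟩
      (continuous_slice har hΩ.continuousOn) (continuous_slice har hΩ.partialZ.continuousOn)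
    simp only [one_pow, one_mul, mul_one] at h2
    have h3 : 0 ≤ q * (q - 1) / 2 * H r := mul_nonneg (by positivity) (hH0 r)
    have h4 : 0 ≤ (1 + q / (2 * (q - 1))) * K r := mul_nonneg (by positivity) (hK0 r)
    simp only [hH, hK, hc] at h3 h4 ⊢
    linarith
  set ε₁ : ℝ := ε / 2 ^ (q + 2) with hε₁
  have hε₁0 : 0 < ε₁ := by positivity
  have hgood : ∀ᶠ R in atTop, ∃ r ∈ Icc R (2 * R), ∀ z, R ^ (q + 2) * |Ω (r, z)| ^ q ≤ ε₁ := by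
    have := eventually_exists_mul_le (M := M + M') (ε := ε₁ / c) hb (cH.add cK)
      (fun r hr => add_nonneg (mul_nonneg (rpow_nonneg (hb.le.trans hr) _) (hH0 r))
        (mul_nonneg (rpow_nonneg (hb.le.trans hr) _) (hK0 r)))
      (fun R hR => by
        have e := intervalIntegral.integral_add
          (intervalIntegrable_of_continuousOn_Ici cH le_rfl hR)
          (intervalIntegrable_of_continuousOn_Ici cK le_rfl hR)
        exact e.trans_le (add_le_add (hMΩ R hR) (hM' R hR)))
      (by positivity)
    filter_upwards [this, eventually_ge_atTop b] with R ⟨r, hr, hle⟩ hbR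
    have hR0 : 0 < R := hb.trans_le hbR
    refine ⟨r, hr, fun z => ?_⟩
    rw [le_div_iff₀ hc0] at hle
    calc R ^ (q + 2) * |Ω (r, z)| ^ q ≤ R ^ (q + 2) * (c * (H r + K r)) := by
          gcongr; exact hsup r (hbR.trans hr.1) z
      _ = R * (R ^ (q + 1) * (H r + K r)) * c := by
          have : R ^ (q + 2) = R ^ (q + 1) * R := by
            rw [← rpow_add_one hR0.ne']; congr 1; ring
          rw [this]; ring
      _ ≤ R * (r ^ (q + 1) * (H r + K r)) * c := by
          have := add_nonneg (hH0 r) (hK0 r)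
          gcongr
          exact hr.1
      _ ≤ ε₁ := by
          refine le_trans (le_of_eq ?_) hle
          simp only [Pi.add_apply]
          ring
  have hneg : ∀ f : ℝ × ℝ → ℝ, partialR (fun p => -f p) = (fun p => -partialR f p) ∧
      partialZ (fun p => -f p) = fun p => -partialZ f p := fun f => by
    constructor <;> ext p <;> simp [partialR, partialZ, fderiv_fun_neg]
  filter_upwards [hgood, (tendsto_id.atTop_div_const two_pos).eventually hgood,
    eventually_ge_atTop (2 * b)] with r ⟨r₂, hr₂, h₂⟩ ⟨r₁, hr₁, h₁⟩ hbr z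
  simp only [id] at hr₁ h₁
  have hr0 : 0 < r := by linarith
  set m : ℝ := (ε₁ / (r / 2) ^ (q + 2)) ^ q⁻¹ with hm
  have hm1 : ∀ z, |Ω (r₁, z)| ≤ m := fun z => by
    rw [hm, le_rpow_inv_iff_of_pos (abs_nonneg _) (by positivity) hq0, le_div_iff₀' (by positivity)]
    exact h₁ z
  have hm2 : ∀ z, |Ω (r₂, z)| ≤ m := fun z => by
    rw [hm, le_rpow_inv_iff_of_pos (abs_nonneg _) (by positivity) hq0, le_div_iff₀' (by positivity)]
    refine le_trans ?_ (h₂ z)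
    gcongr
    linarith
  have hab₁ : a < r₁ := hab.trans_le (by linarith [hr₁.1])
  have hrI : r ∈ Icc r₁ r₂ := ⟨by linarith [hr₁.2], hr₂.1⟩
  have hle : Ω (r, z) ≤ m := maximum_principle hab₁ hΩ hΩper hu.continuousOn ha heq
    (fun z => (le_abs_self _).trans (hm1 z)) (fun z => (le_abs_self _).trans (hm2 z)) hrI z
  have hge : -Ω (r, z) ≤ m := maximum_principle (f := fun p => -Ω p) (w := w) hab₁ hΩ.neg
    (fun r z => by rw [hΩper]) hu.continuousOn ha
    (fun p hp => by
      rw [(hneg Ω).1, (hneg Ω).2, (hneg _).1, (hneg _).2]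
      linear_combination -(heq p hp))
    (fun z => (neg_le_abs _).trans (hm1 z)) (fun z => (neg_le_abs _).trans (hm2 z)) hrI z
  have habs : |Ω (r, z)| ≤ m := abs_le'.2 ⟨hle, hge⟩
  rw [hm, le_rpow_inv_iff_of_pos (abs_nonneg _) (by positivity) hq0, le_div_iff₀' (by positivity),
    div_rpow hr0.le two_pos.le, hε₁, div_mul_eq_mul_div] at habs
  exact (div_le_div_iff_of_pos_right (by positivity)).1 habs

/-- Integration over `ℝ³` of a function of `(r, z)` in cylindrical coordinates. -/
lemma lintegral_comp_rr {F : ℝ × ℝ → ENNReal} (hF : Measurable F) :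
    ∫⁻ x : E3, F (rr x, x 2)
      = ENNReal.ofReal (2 * π) * ∫⁻ z, ∫⁻ r in Ioi 0, ENNReal.ofReal r * F (r, z) := by
  have hm : Measurable fun y : ℝ × ℝ × ℝ => F (√(y.2.1 ^ 2 + y.2.2 ^ 2), y.1) := by fun_prop
  have hm' : Measurable fun y : Fin 3 → ℝ => F (√(y 0 ^ 2 + y 1 ^ 2), y 2) := by fun_prop
  have hm'' : Measurable fun y : ℝ × (Fin 2 → ℝ) => F (√(y.2 0 ^ 2 + y.2 1 ^ 2), y.1) := by
    fun_prop
  have e1 : ∫⁻ x : E3, F (rr x, x 2) = ∫⁻ y : Fin 3 → ℝ, F (√(y 0 ^ 2 + y 1 ^ 2), y 2) :=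
    (PiLp.volume_preserving_ofLp (Fin 3)).lintegral_comp hm'
  have e2 : ∫⁻ y : Fin 3 → ℝ, F (√(y 0 ^ 2 + y 1 ^ 2), y 2)
      = ∫⁻ y : ℝ × (Fin 2 → ℝ), F (√(y.2 0 ^ 2 + y.2 1 ^ 2), y.1) :=
    (volume_preserving_piFinSuccAbove (fun _ : Fin 3 => ℝ) 2).lintegral_comp hm''
  have e3 : ∫⁻ y : ℝ × (Fin 2 → ℝ), F (√(y.2 0 ^ 2 + y.2 1 ^ 2), y.1)
      = ∫⁻ y : ℝ × ℝ × ℝ, F (√(y.2.1 ^ 2 + y.2.2 ^ 2), y.1) :=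
    ((MeasurePreserving.id volume).prod (volume_preserving_finTwoArrow ℝ)).lintegral_comp hm
  rw [e1, e2, e3, Measure.volume_eq_prod, lintegral_prod _ hm.aemeasurable,
    ← lintegral_const_mul' _ _ ENNReal.ofReal_ne_top]
  congr 1
  ext z
  rw [← lintegral_comp_polarCoord_symm fun y : ℝ × ℝ => F (√(y.1 ^ 2 + y.2 ^ 2), z),
    polarCoord_target, Measure.volume_eq_prod, setLIntegral_prod,
    ← lintegral_const_mul' _ _ ENNReal.ofReal_ne_top]
  · refine setLIntegral_congr_fun measurableSet_Ioi fun r hr => ?_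
    have hr : 0 < r := hr
    have : ∀ θ : ℝ, √((r * cos θ) ^ 2 + (r * sin θ) ^ 2) = r := fun θ => by
      rw [mul_pow, mul_pow, ← mul_add, cos_sq_add_sin_sq, mul_one, sqrt_sq hr.le]
    simp only [polarCoord_symm_apply, this, lintegral_const, smul_eq_mul,
      Measure.restrict_apply_univ, Real.volume_Ioo]
    rw [mul_comm, sub_neg_eq_add, ← two_mul]
  · simp only [polarCoord_symm_apply]
    fun_prop

lemma hasDerivAt_comp_add_smul {a : ℝ} {f : E3 → ℝ}
    (hf : ContDiffOn ℝ (⊤ : ℕ∞) f {x : E3 | a < rr x}) {x : E3} (hx : a < rr x) (c₀ c₁ c₂ : ℝ) :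
    HasDerivAt (fun t : ℝ => f (x + t • !₂[c₀, c₁, c₂]))
      (c₀ * pd 0 f x + c₁ * pd 1 f x + c₂ * pd 2 f x) 0 := by
  have h1 : HasDerivAt (fun t : ℝ => x + t • !₂[c₀, c₁, c₂]) !₂[c₀, c₁, c₂] 0 := by
    simpa using ((hasDerivAt_id (0 : ℝ)).smul_const !₂[c₀, c₁, c₂]).const_add x
  have h2 := (show HasFDerivAt f (fderiv ℝ f x) (x + (0 : ℝ) • !₂[c₀, c₁, c₂]) by
    simpa using hasFDerivAt_of_lt_rr hf hx).comp_hasDerivAt 0 h1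
  refine h2.congr_deriv ?_
  have e : (!₂[c₀, c₁, c₂] : E3) = c₀ • EuclideanSpace.single (0 : Fin 3) (1 : ℝ)
      + c₁ • EuclideanSpace.single (1 : Fin 3) (1 : ℝ)
      + c₂ • EuclideanSpace.single (2 : Fin 3) (1 : ℝ) := by
    ext i; fin_cases i <;> simp
  rw [e]
  simp [pd]

namespace AxisymNoSwirlNSSlab

variable {r₀ : ℝ} {v : E3 → E3} {P : E3 → ℝ} {vr vz : ℝ → ℝ → ℝ}

/-- The derivatives of the cylindrical components are controlled by the full gradient. -/
lemma sq_partial_le_gradSq3 (hr₀ : 0 < r₀) (h : AxisymNoSwirlNSSlab r₀ v P vr vz) {x : E3}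
    (hx : r₀ < rr x) :
    partialR (fun p => v (meridian p) 0) (rr x, x 2) ^ 2 ≤ gradSq3 v x ∧
    (partialZ (fun p => v (meridian p) 0) (rr x, x 2)
      - partialR (fun p => v (meridian p) 2) (rr x, x 2)) ^ 2 ≤ 2 * gradSq3 v x := by
  have hx0 : 0 < rr x := hr₀.trans hx
  set c₀ := x 0 / rr x with hc₀
  set c₁ := x 1 / rr x with hc₁
  have e₀ : x 0 = c₀ * rr x := by rw [hc₀, div_mul_cancel₀ _ hx0.ne']
  have e₁ : x 1 = c₁ * rr x := by rw [hc₁, div_mul_cancel₀ _ hx0.ne']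
  have hc : c₀ ^ 2 + c₁ ^ 2 = 1 := by
    have : rr x ^ 2 = x 0 ^ 2 + x 1 ^ 2 := sq_sqrt (by positivity)
    rw [hc₀, hc₁, div_pow, div_pow, ← add_div, ← this, div_self (by positivity)]
  have hrad : ∀ᶠ t : ℝ in 𝓝 0, v (x + t • !₂[c₀, c₁, 0]) 0 = v (meridian (rr x + t, x 2)) 0 * c₀ ∧
      v (x + t • !₂[c₀, c₁, 0]) 1 = v (meridian (rr x + t, x 2)) 0 * c₁ ∧
      v (x + t • !₂[c₀, c₁, 0]) 2 = v (meridian (rr x + t, x 2)) 2 := by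
    filter_upwards [lt_mem_nhds (show r₀ - rr x < 0 by linarith)] with t ht
    have ht : r₀ < rr x + t := by linarith
    have ht0 := hr₀.trans ht
    have y0 : (x + t • !₂[c₀, c₁, 0]) 0 = (rr x + t) * c₀ := by
      simp; linear_combination e₀
    have y1 : (x + t • !₂[c₀, c₁, 0]) 1 = (rr x + t) * c₁ := by
      simp; linear_combination e₁
    have y2 : (x + t • !₂[c₀, c₁, 0]) 2 = x 2 := by simp
    have hr : rr (x + t • !₂[c₀, c₁, 0]) = rr x + t := by
      rw [rr, y0, y1, mul_pow, mul_pow, ← mul_add, hc, mul_one, sqrt_sq ht0.le]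
    have := h.apply_eq_meridian hr₀ (x := x + t • !₂[c₀, c₁, 0]) (by rwa [hr])
    rwa [hr, y0, y1, y2, mul_div_cancel_left₀ _ ht0.ne', mul_div_cancel_left₀ _ ht0.ne'] at this
  have hver : ∀ t : ℝ, v (x + t • !₂[0, 0, 1]) 0 = v (meridian (rr x, x 2 + t)) 0 * c₀ ∧
      v (x + t • !₂[0, 0, 1]) 1 = v (meridian (rr x, x 2 + t)) 0 * c₁ := by
    intro t
    have y0 : (x + t • !₂[(0 : ℝ), 0, 1]) 0 = x 0 := by simp
    have y1 : (x + t • !₂[(0 : ℝ), 0, 1]) 1 = x 1 := by simp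
    have y2 : (x + t • !₂[(0 : ℝ), 0, 1]) 2 = x 2 + t := by simp
    have hr : rr (x + t • !₂[(0 : ℝ), 0, 1]) = rr x := by rw [rr, y0, y1, rr]
    have := h.apply_eq_meridian hr₀ (x := x + t • !₂[(0 : ℝ), 0, 1]) (by rwa [hr])
    rw [hr, y0, y1, y2] at this
    exact ⟨this.1, this.2.1⟩
  have hR : ∀ j, HasDerivAt (fun t : ℝ => v (meridian (rr x + t, x 2)) j)
      (partialR (fun p => v (meridian p) j) (rr x, x 2)) 0 := fun j => by
    have h1 := (h.smoothRight hr₀ j).hasDerivAt_fst (z := x 2) hx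
    rw [← add_zero (rr x)] at h1
    simpa using h1.comp_const_add (rr x) 0
  have hZ : HasDerivAt (fun t : ℝ => v (meridian (rr x, x 2 + t)) 0)
      (partialZ (fun p => v (meridian p) 0) (rr x, x 2)) 0 := by
    have h1 := (h.smoothRight hr₀ 0).hasDerivAt_snd (z := x 2) hx
    rw [← add_zero (x 2)] at h1
    simpa using h1.comp_const_add (x 2) 0
  have E0 := (hasDerivAt_comp_add_smul (h.contDiffOn_apply 0) hx c₀ c₁ 0).unique
    (((hR 0).mul_const c₀).congr_of_eventuallyEq (hrad.mono fun t ht => ht.1))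
  have E1 := (hasDerivAt_comp_add_smul (h.contDiffOn_apply 1) hx c₀ c₁ 0).unique
    (((hR 0).mul_const c₁).congr_of_eventuallyEq (hrad.mono fun t ht => ht.2.1))
  have E2 := (hasDerivAt_comp_add_smul (h.contDiffOn_apply 2) hx c₀ c₁ 0).unique
    ((hR 2).congr_of_eventuallyEq (hrad.mono fun t ht => ht.2.2))
  have E3 := (hasDerivAt_comp_add_smul (h.contDiffOn_apply 0) hx 0 0 1).unique
    ((hZ.mul_const c₀).congr_of_eventuallyEq (.of_forall fun t => (hver t).1))
  have E4 := (hasDerivAt_comp_add_smul (h.contDiffOn_apply 1) hx 0 0 1).unique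
    ((hZ.mul_const c₁).congr_of_eventuallyEq (.of_forall fun t => (hver t).2))
  have hcs : ∀ s t : ℝ, (c₀ * s + c₁ * t) ^ 2 ≤ s ^ 2 + t ^ 2 := fun s t => by
    calc (c₀ * s + c₁ * t) ^ 2 ≤ (c₀ ^ 2 + c₁ ^ 2) * (s ^ 2 + t ^ 2) := by
          linarith [sq_nonneg (c₀ * t - c₁ * s)]
      _ = s ^ 2 + t ^ 2 := by rw [hc, one_mul]
  simp only [zero_mul, one_mul, zero_add, add_zero] at E0 E1 E2 E3 E4
  have hg : gradSq3 v x = ∑ i, ∑ j, (pd i (fun y => v y j) x) ^ 2 := rfl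
  simp only [Fin.sum_univ_three] at hg
  set U := partialR (fun p => v (meridian p) 0) (rr x, x 2)
  set W := partialR (fun p => v (meridian p) 2) (rr x, x 2)
  set V := partialZ (fun p => v (meridian p) 0) (rr x, x 2)
  have hU : U ^ 2 ≤ pd 0 (fun y => v y 0) x ^ 2 + pd 1 (fun y => v y 0) x ^ 2
      + (pd 0 (fun y => v y 1) x ^ 2 + pd 1 (fun y => v y 1) x ^ 2) := by
    refine le_trans (le_of_eq ?_) (add_le_add (hcs _ _) (hcs _ _))
    rw [E0, E1]; linear_combination -U ^ 2 * hc
  have hW : W ^ 2 ≤ pd 0 (fun y => v y 2) x ^ 2 + pd 1 (fun y => v y 2) x ^ 2 := by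
    rw [← E2]; exact hcs _ _
  have hV : V ^ 2 = pd 2 (fun y => v y 0) x ^ 2 + pd 2 (fun y => v y 1) x ^ 2 := by
    rw [E3, E4]; linear_combination -V ^ 2 * hc
  have hpos : ∀ i j, 0 ≤ (pd i (fun y => v y j) x) ^ 2 := fun i j => sq_nonneg _
  constructor
  · linarith [hpos 0 2, hpos 1 2, hpos 2 0, hpos 2 1, hpos 2 2]
  · linarith [hpos 0 0, hpos 0 1, hpos 1 0, hpos 1 1, hpos 2 2, sq_nonneg (V + W)]

end AxisymNoSwirlNSSlab

lemma integral_integral_le_of_lintegral {a b R : ℝ} (ha : 0 ≤ a) (hab : a < b) (hbR : b ≤ R)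
    {g : ℝ × ℝ → ℝ} (hg : ContinuousOn g (halfPlane a)) (hg0 : ∀ p, 0 ≤ g p)
    {S : E3 → ENNReal} (hS : ∀ x, a < rr x → ENNReal.ofReal (g (rr x, x 2)) ≤ S x)
    (hfin : ∫⁻ x in {x : E3 | a < rr x ∧ x 2 ∈ Icc (-π) π}, S x ≠ ⊤) :
    ∫ r in b..R, ∫ z in -π..π, r * g (r, z)
      ≤ (∫⁻ x in {x : E3 | a < rr x ∧ x 2 ∈ Icc (-π) π}, S x).toReal := by
  have hpi : -π ≤ π := by linarith [pi_pos]
  have hb : 0 < b := ha.trans_lt hab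
  have hG := continuous_clamp hab hg
  set F : ℝ × ℝ → ENNReal := (Icc b R ×ˢ Icc (-π) π).indicator
    fun p => ENNReal.ofReal (g (max p.1 b, p.2)) with hF
  have hFm : Measurable F :=
    hG.measurable.ennreal_ofReal.indicator (measurableSet_Icc.prod measurableSet_Icc)
  have hle : ∫⁻ x : E3, F (rr x, x 2)
      ≤ ∫⁻ x in {x : E3 | a < rr x ∧ x 2 ∈ Icc (-π) π}, S x := by
    have hD : MeasurableSet {x : E3 | a < rr x ∧ x 2 ∈ Icc (-π) π} :=
      (isOpen_lt_rr a).measurableSet.inter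
        (measurableSet_Icc.preimage (by fun_prop : Measurable fun x : E3 => x 2))
    rw [← lintegral_indicator hD]
    refine lintegral_mono fun x => ?_
    by_cases hx : (rr x, x 2) ∈ Icc b R ×ˢ Icc (-π) π
    · have hax : a < rr x := hab.trans_le hx.1.1
      rw [hF, indicator_of_mem hx, indicator_of_mem
        (show x ∈ {x : E3 | a < rr x ∧ x 2 ∈ Icc (-π) π} from ⟨hax, hx.2⟩)]
      simp only [max_eq_left hx.1.1]
      exact hS x hax
    · rw [hF, indicator_of_notMem hx]
      exact zero_le
  have hcont : Continuous fun p : ℝ × ℝ => p.2 * g (max p.2 b, p.1) :=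
    continuous_snd.mul (hG.comp continuous_swap)
  have hint : IntegrableOn (fun p : ℝ × ℝ => p.2 * g (max p.2 b, p.1))
      (Icc (-π) π ×ˢ Icc b R) (volume.prod volume) :=
    hcont.continuousOn.integrableOn_compact (isCompact_Icc.prod isCompact_Icc)
  have e1 : ∫ r in b..R, ∫ z in -π..π, r * g (r, z)
      = ∫ p in Icc (-π) π ×ˢ Icc b R, p.2 * g (max p.2 b, p.1) ∂(volume.prod volume) := by
    rw [integral_integral_swap_of_continuousOn hab hbR (f := fun p => p.1 * g p)
      (continuousOn_fst.mul hg), setIntegral_prod _ hint, intervalIntegral.integral_of_le hpi,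
      integral_Icc_eq_integral_Ioc]
    refine setIntegral_congr_fun measurableSet_Ioc fun z _ => ?_
    dsimp only
    rw [intervalIntegral.integral_of_le hbR, integral_Icc_eq_integral_Ioc]
    refine setIntegral_congr_fun measurableSet_Ioc fun r hr => ?_
    simp only [max_eq_left hr.1.le]
  have e2 : ENNReal.ofReal (∫ r in b..R, ∫ z in -π..π, r * g (r, z))
      ≤ ∫⁻ z, ∫⁻ r in Ioi 0, ENNReal.ofReal r * F (r, z) := by
    rw [e1, ofReal_integral_eq_lintegral_ofReal hint, setLIntegral_prod]
    · rw [← lintegral_indicator measurableSet_Icc]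
      refine lintegral_mono fun z => ?_
      by_cases hz : z ∈ Icc (-π) π
      · rw [indicator_of_mem hz]
        refine (lintegral_mono_set (s := Icc b R) (fun r hr => hb.trans_le hr.1)).trans' ?_
        refine setLIntegral_mono' measurableSet_Icc fun r hr => ?_
        rw [hF, indicator_of_mem (show (r, z) ∈ Icc b R ×ˢ Icc (-π) π from ⟨hr, hz⟩),
          ENNReal.ofReal_mul (hb.le.trans hr.1)]
      · rw [indicator_of_notMem hz]
        exact zero_le
    · exact hcont.measurable.ennreal_ofReal.aemeasurable
    · filter_upwards [ae_restrict_mem (measurableSet_Icc.prod measurableSet_Icc)] with p hp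
      exact mul_nonneg (hb.le.trans hp.2.1) (hg0 _)
  rw [lintegral_comp_rr hFm] at hle
  refine ENNReal.ofReal_le_iff_le_toReal hfin |>.1 ((e2.trans ?_).trans hle)
  refine le_mul_of_one_le_left zero_le ?_
  rw [ENNReal.one_le_ofReal]
  linarith [pi_gt_three]

lemma abs_rpow_le_of_sq_le {s G c q : ℝ} (hq : 0 < q) (hc : 0 ≤ c) (hG : 0 ≤ G)
    (h : s ^ 2 ≤ c * G) :
    |s| ^ q ≤ c ^ (q / 2) * G ^ (q / 2) := by
  rw [← mul_rpow hc hG]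
  calc |s| ^ q = (s ^ 2) ^ (q / 2) := by
        rw [← sq_abs, ← rpow_natCast, ← rpow_mul (abs_nonneg s)]; congr 1; push_cast; ring
    _ ≤ _ := rpow_le_rpow (sq_nonneg s) h (by positivity)

/-- decay of `ω^θ` in Theorem 1.1 for `q > 2`:
`r^{2/q − 1/q²} sup_z |ω^θ(r,z)| → 0` as `r → ∞`. -/
theorem omega_decay_q_gt_two (r₀ q : ℝ) (hr₀ : 0 < r₀) (hq : 2 < q)
    (v : E3 → E3) (p : E3 → ℝ) (vr vz : ℝ → ℝ → ℝ)
    (hsol : AxisymNoSwirlNSSlab r₀ v p vr vz)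
    (hdiri : ∫⁻ x : E3 in {x : E3 | r₀ < rr x ∧ x 2 ∈ Icc (-π) π},
      ENNReal.ofReal ((gradSq3 v x) ^ (q / 2)) < ⊤) :
    Tendsto
      (fun r : ℝ => r ^ (2 / q - 1 / q ^ 2) *
        ⨆ z : (Icc (-π) π : Set ℝ), |omTheta vr vz r (z : ℝ)|)
      atTop (𝓝 0) := by
  have hq0 : 0 < q := by linarith
  set u : ℝ × ℝ → ℝ := fun p => v (meridian p) 0
  set w : ℝ × ℝ → ℝ := fun p => v (meridian p) 2
  set ω : ℝ × ℝ → ℝ := fun p => partialZ u p - partialR w p with hω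
  set Ω : ℝ × ℝ → ℝ := fun p => ω p / p.1 with hΩ
  have hu : SmoothRight r₀ u := hsol.smoothRight hr₀ 0
  have hw : SmoothRight r₀ w := hsol.smoothRight hr₀ 2
  have hωs : SmoothRight r₀ ω := hu.partialZ.sub hw.partialR
  have hΩs : SmoothRight r₀ Ω := hωs.div_fst hr₀.le
  have hwper := hsol.periodic_meridian 2
  have hΩper : ∀ r z, Ω (r, z + 2 * π) = Ω (r, z) := fun r z => by
    simp only [hΩ, hω]
    rw [partialZ_periodic (hsol.periodic_meridian 0), partialR_periodic hwper]
  have habs : ∀ (f : ℝ × ℝ → ℝ), ContinuousOn f (halfPlane r₀) →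
      ContinuousOn (fun p => |f p| ^ q) (halfPlane r₀) := fun f hf =>
    hf.abs.rpow_const fun _ _ => Or.inr hq0.le
  have hgrad : ∀ x, 0 ≤ gradSq3 v x := fun x =>
    Finset.sum_nonneg fun i _ => Finset.sum_nonneg fun j _ => sq_nonneg _
  set S : E3 → ENNReal := fun x =>
    ENNReal.ofReal (2 ^ (q / 2)) * ENNReal.ofReal (gradSq3 v x ^ (q / 2)) with hS
  have hfin : ∫⁻ x in {x : E3 | r₀ < rr x ∧ x 2 ∈ Icc (-π) π}, S x ≠ ⊤ := by
    rw [hS, lintegral_const_mul' _ _ ENNReal.ofReal_ne_top]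
    exact ENNReal.mul_ne_top ENNReal.ofReal_ne_top hdiri.ne
  have hbound : ∀ s x, s ^ 2 ≤ 2 * gradSq3 v x → ENNReal.ofReal (|s| ^ q) ≤ S x :=
    fun s x hs => by
      simp only [hS]
      rw [← ENNReal.ofReal_mul (by positivity)]
      exact ENNReal.ofReal_le_ofReal (abs_rpow_le_of_sq_le hq0 two_pos.le (hgrad x) hs)
  have hMu := fun R (hR : r₀ + 1 ≤ R) => integral_integral_le_of_lintegral hr₀.le
    (lt_add_one r₀) hR (habs _ hu.partialR.continuousOn)
    (fun p => rpow_nonneg (abs_nonneg _) _)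
    (fun x hx => hbound _ x (by
      linarith [(hsol.sq_partial_le_gradSq3 hr₀ hx).1, hgrad x])) hfin
  have hMΩ := fun R (hR : r₀ + 1 ≤ R) => integral_integral_le_of_lintegral hr₀.le
    (lt_add_one r₀) hR (habs _ hωs.continuousOn)
    (fun p => rpow_nonneg (abs_nonneg _) _)
    (fun x hx => hbound _ x (hsol.sq_partial_le_gradSq3 hr₀ hx).2) hfin
  have hωΩ : ∀ r z, 0 < r → |ω (r, z)| ^ q = r ^ q * |Ω (r, z)| ^ q := fun r z hr => by
    rw [hΩ, abs_div, abs_of_pos hr, div_rpow (abs_nonneg _) hr.le,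
      mul_div_cancel₀ _ (rpow_pos_of_pos hr q).ne']
  have hMΩ' : ∀ R, r₀ + 1 ≤ R → ∫ r in (r₀ + 1)..R, r ^ (q + 1) * ∫ z in -π..π, |Ω (r, z)| ^ q
      ≤ (∫⁻ x in {x : E3 | r₀ < rr x ∧ x 2 ∈ Icc (-π) π}, S x).toReal := fun R hR => by
    refine le_trans (le_of_eq ?_) (hMΩ R hR)
    refine intervalIntegral.integral_congr fun r hr => ?_
    rw [uIcc_of_le hR] at hr
    have hr0 : 0 < r := by linarith [hr.1]
    simp only [← intervalIntegral.integral_const_mul]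
    refine intervalIntegral.integral_congr fun z _ => ?_
    simp only [hωΩ r z hr0, rpow_add_one hr0.ne']
    ring
  have hom : ∀ r z, r₀ < r → omTheta vr vz r z = ω (r, z) := fun r z hr => by
    have h1 : HasDerivAt (fun t => vr r t) (partialZ u (r, z)) z :=
      (hu.hasDerivAt_snd hr).congr_of_eventuallyEq
        (.of_forall fun t => (hsol.apply_zero_meridian hr₀ (p := (r, t)) hr).symm)
    have h2 : HasDerivAt (fun s => vz s z) (partialR w (r, z)) r := by
      refine (hw.hasDerivAt_fst hr).congr_of_eventuallyEq ?_
      filter_upwards [lt_mem_nhds hr] with s hs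
      exact (hsol.apply_two_meridian hr₀ (p := (s, z)) hs).symm
    rw [omTheta, dzz, dr, h1.deriv, h2.deriv]
  refine tendsto_order.2 ⟨fun c hc => ?_, fun c hc => ?_⟩
  · filter_upwards [eventually_ge_atTop 0] with r hr
    exact hc.trans_le (mul_nonneg (rpow_nonneg hr _) (Real.iSup_nonneg fun _ => abs_nonneg _))
  filter_upwards [eventually_rpow_mul_le hr₀.le (lt_add_one r₀) hq hu hw hΩs hwper hΩper
    (fun p hp => hsol.incompressible_meridian hr₀ hp)
    (fun p hp => hsol.scaled_vorticity_meridian hr₀ (fun _ _ => rfl) hp) hMu hMΩ'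
    (rpow_pos_of_pos (half_pos hc) q), eventually_gt_atTop r₀, eventually_ge_atTop 1]
    with r hr hrr hr1
  have hr0 : 0 < r := by linarith
  have hpt : ∀ z, r ^ (2 / q) * |ω (r, z)| ≤ c / 2 := fun z => by
    rw [← rpow_le_rpow_iff (by positivity) (by positivity) hq0, mul_rpow (by positivity)
      (abs_nonneg _), ← rpow_mul hr0.le, div_mul_cancel₀ _ hq0.ne', hωΩ r z hr0, ← mul_assoc,
      ← rpow_add hr0, add_comm]
    exact hr z
  have hsup : ⨆ z : (Icc (-π) π : Set ℝ), |omTheta vr vz r (z : ℝ)| ≤ c / 2 / r ^ (2 / q) := by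
    refine Real.iSup_le (fun z => ?_) (by positivity)
    rw [hom r z hrr, le_div_iff₀' (by positivity)]
    exact hpt z
  calc r ^ (2 / q - 1 / q ^ 2) * ⨆ z : (Icc (-π) π : Set ℝ), |omTheta vr vz r (z : ℝ)|
      ≤ r ^ (2 / q) * (c / 2 / r ^ (2 / q)) := by
        refine mul_le_mul (rpow_le_rpow_of_exponent_le hr1 ?_) hsup
          (Real.iSup_nonneg fun _ => abs_nonneg _) (by positivity)
        linarith [show 0 ≤ 1 / q ^ 2 by positivity]
    _ = c / 2 := mul_div_cancel₀ _ (by positivity)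
    _ < c := half_lt_self hc
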